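/- arXiv:2003.05135 — 10 statements merged into one kernel-verified Lean document; each statement's English description precedes it below -/
import Mathlib

section
/- Let f₀ be a probability density on [0,∞)², let ρ : [0,∞)² → ℝ be measurable, let q ∈ [0,1], and suppose that f₁(y,v) := f₀(y,v)(1 + qρ(y,v)) is again a probability density on [0,∞)². Assume ∫_{[0,∞)²} f₀(y,v) ρ(y,v) dy dv = 0 and set C₀ := ∫_{[0,∞)²} f₀(y,v) ρ(y,v)² dy dv, assumed finite. Then for every n ≥ 1, T_V(f₀^{⊗n}, f₁^{⊗n}) ≤ (1/2)√((1 + q²C₀)ⁿ − 1). -/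
open MeasureTheory Real Set

/-- Total variation is bounded by the chi-square divergence: if `F` and `F * R` have integral `1` and
`F ≥ 0`, then `∫ |F - F * R| ≤ √(∫ F * R ^ 2 - 1)`. -/
theorem integral_abs_sub_mul_le_sqrt {α : Type*} [MeasurableSpace α] {ν : Measure α}
    {F R : α → ℝ} (hF : ∀ᵐ x ∂ν, 0 ≤ F x) (hFi : Integrable F ν)
    (hFRi : Integrable (fun x => F x * R x) ν) (hFR2i : Integrable (fun x => F x * R x ^ 2) ν)
    (hF1 : ∫ x, F x ∂ν = 1) (hFR1 : ∫ x, F x * R x ∂ν = 1) :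
    ∫ x, |F x - F x * R x| ∂ν ≤ √((∫ x, F x * R x ^ 2 ∂ν) - 1) := by
  set M := ∫ x, |F x - F x * R x| ∂ν
  have hDi : Integrable (fun x => |F x - F x * R x|) ν := (hFi.sub hFRi).abs
  have hexp : ∀ᵐ x ∂ν, 0 ≤ F x * R x ^ 2 - 2 * (F x * R x) + (1 + M ^ 2) * F x
      - 2 * M * |F x - F x * R x| := by
    filter_upwards [hF] with x hx
    have habs : |F x - F x * R x| = F x * |1 - R x| := by
      rw [← mul_one_sub, abs_mul, abs_of_nonneg hx]
    have hsq : F x * (|1 - R x| - M) ^ 2 = F x * R x ^ 2 - 2 * (F x * R x) + (1 + M ^ 2) * F x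
        - 2 * M * |F x - F x * R x| := by
      rw [habs, sub_sq, sq_abs]
      ring
    rw [← hsq]
    positivity
  have hint := integral_nonneg_of_ae hexp
  have hi₁ : Integrable (fun x => F x * R x ^ 2 - 2 * (F x * R x)) ν :=
    hFR2i.sub (hFRi.const_mul 2)
  have hi₂ : Integrable (fun x => F x * R x ^ 2 - 2 * (F x * R x) + (1 + M ^ 2) * F x) ν :=
    hi₁.add (hFi.const_mul _)
  rw [integral_sub hi₂ (hDi.const_mul _), integral_add hi₁ (hFi.const_mul _),
    integral_sub hFR2i (hFRi.const_mul 2), integral_const_mul, integral_const_mul,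
    integral_const_mul, hF1, hFR1] at hint
  change 0 ≤ _ - 2 * M * M at hint
  apply Real.le_sqrt_of_sq_le
  linarith

/-- With `f₀` a probability density on `[0,∞)²`, `ρ` measurable,
`q ∈ [0,1]`, `f₁ = f₀(1+qρ)` again a probability density on `[0,∞)²`,
`∫ f₀ ρ = 0` and `C₀ = ∫ f₀ ρ² < ∞`, for every `n ≥ 1`
`T_V(f₀^{⊗n}, f₁^{⊗n}) ≤ (1/2)√((1 + q²C₀)ⁿ − 1)`. -/
theorem total_variation_tensor_power_upper_bound
    (f₀ ρ : ℝ × ℝ → ℝ) (q : ℝ) (hq : q ∈ Set.Icc (0:ℝ) 1)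
    (hf₀meas : Measurable f₀) (hρmeas : Measurable ρ)
    (hf₀nonneg : ∀ x ∈ Set.Ici (0:ℝ) ×ˢ Set.Ici (0:ℝ), 0 ≤ f₀ x)
    (hf₀int : IntegrableOn f₀ (Set.Ici (0:ℝ) ×ˢ Set.Ici (0:ℝ)))
    (hf₀one : ∫ x in Set.Ici (0:ℝ) ×ˢ Set.Ici (0:ℝ), f₀ x = 1)
    (hf₁nonneg : ∀ x ∈ Set.Ici (0:ℝ) ×ˢ Set.Ici (0:ℝ), 0 ≤ f₀ x * (1 + q * ρ x))
    (hf₁int : IntegrableOn (fun x => f₀ x * (1 + q * ρ x))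
      (Set.Ici (0:ℝ) ×ˢ Set.Ici (0:ℝ)))
    (hf₁one : ∫ x in Set.Ici (0:ℝ) ×ˢ Set.Ici (0:ℝ), f₀ x * (1 + q * ρ x) = 1)
    (hmeanint : IntegrableOn (fun x => f₀ x * ρ x) (Set.Ici (0:ℝ) ×ˢ Set.Ici (0:ℝ)))
    (hmean : ∫ x in Set.Ici (0:ℝ) ×ˢ Set.Ici (0:ℝ), f₀ x * ρ x = 0)
    (hC₀int : IntegrableOn (fun x => f₀ x * ρ x ^ 2) (Set.Ici (0:ℝ) ×ˢ Set.Ici (0:ℝ)))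
    (C₀ : ℝ)
    (hC₀ : C₀ = ∫ x in Set.Ici (0:ℝ) ×ˢ Set.Ici (0:ℝ), f₀ x * ρ x ^ 2)
    (n : ℕ) (hn : 1 ≤ n) :
    (1/2) * (∫ x in (Set.univ.pi fun _ : Fin n => Set.Ici (0:ℝ) ×ˢ Set.Ici (0:ℝ)),
        |(∏ i, f₀ (x i)) - ∏ i, f₀ (x i) * (1 + q * ρ (x i))|)
      ≤ (1/2) * Real.sqrt ((1 + q ^ 2 * C₀) ^ n - 1) := by
  have hS : MeasurableSet (Set.Ici (0 : ℝ) ×ˢ Set.Ici (0 : ℝ)) :=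
    measurableSet_Ici.prod measurableSet_Ici
  have hexp (x : ℝ × ℝ) : f₀ x * (1 + q * ρ x) ^ 2
      = f₀ x + 2 * q * (f₀ x * ρ x) + q ^ 2 * (f₀ x * ρ x ^ 2) := by
    ring
  have hlin : IntegrableOn (fun x => f₀ x + 2 * q * (f₀ x * ρ x))
      (Set.Ici (0 : ℝ) ×ˢ Set.Ici (0 : ℝ)) :=
    hf₀int.add (hmeanint.const_mul _)
  have hf₂int : IntegrableOn (fun x => f₀ x * (1 + q * ρ x) ^ 2)
      (Set.Ici (0 : ℝ) ×ˢ Set.Ici (0 : ℝ)) := by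
    simp_rw [hexp]
    exact hlin.add (hC₀int.const_mul _)
  have hf₂ : ∫ x in Set.Ici (0 : ℝ) ×ˢ Set.Ici (0 : ℝ), f₀ x * (1 + q * ρ x) ^ 2
      = 1 + q ^ 2 * C₀ := by
    simp_rw [hexp]
    rw [integral_add hlin (hC₀int.const_mul _),
      integral_add hf₀int (hmeanint.const_mul _), integral_const_mul, integral_const_mul,
      hf₀one, hmean, ← hC₀]
    ring
  have hnonneg : ∀ᵐ x ∂(volume : Measure (Fin n → ℝ × ℝ)).restrict
      (Set.univ.pi fun _ : Fin n => Set.Ici (0 : ℝ) ×ˢ Set.Ici (0 : ℝ)),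
      0 ≤ ∏ i, f₀ (x i) := by
    filter_upwards [ae_restrict_mem (MeasurableSet.univ_pi fun _ => hS)] with x hx
    exact Finset.prod_nonneg fun i _ => hf₀nonneg _ (hx i (Set.mem_univ i))
  rw [volume_pi, Measure.restrict_pi_pi] at hnonneg ⊢
  have hprod (x : Fin n → ℝ × ℝ) : ∏ i, f₀ (x i) * (1 + q * ρ (x i)) ^ 2
      = (∏ i, f₀ (x i)) * (∏ i, (1 + q * ρ (x i))) ^ 2 := by
    rw [Finset.prod_mul_distrib, Finset.prod_pow]
  have hFi := Integrable.fintype_prod (ι := Fin n) fun _ => hf₀int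
  have hFRi := Integrable.fintype_prod (ι := Fin n) fun _ => hf₁int
  have hFR2i := Integrable.fintype_prod (ι := Fin n) fun _ => hf₂int
  have hF1 := integral_fintype_prod_eq_pow (ι := Fin n)
    (μ := volume.restrict (Set.Ici (0 : ℝ) ×ˢ Set.Ici (0 : ℝ))) f₀
  have hFR1 := integral_fintype_prod_eq_pow (ι := Fin n)
    (μ := volume.restrict (Set.Ici (0 : ℝ) ×ˢ Set.Ici (0 : ℝ))) fun x => f₀ x * (1 + q * ρ x)
  have hFR21 := integral_fintype_prod_eq_pow (ι := Fin n)
    (μ := volume.restrict (Set.Ici (0 : ℝ) ×ˢ Set.Ici (0 : ℝ))) fun x => f₀ x * (1 + q * ρ x) ^ 2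
  rw [hf₀one, one_pow] at hF1
  rw [hf₁one, one_pow] at hFR1
  rw [hf₂, Fintype.card_fin] at hFR21
  simp only [hprod] at hFR2i hFR21
  simp only [Finset.prod_mul_distrib] at hFRi hFR1 ⊢
  rw [← hFR21]
  gcongr
  exact integral_abs_sub_mul_le_sqrt hnonneg hFi hFRi hFR2i hF1 hFR1
end

section
/- Let λ > 0 and μ₁, μ₂ > 0, and define ρ : [0,∞)² → ℝ by ρ(x,v) = e^{−μ₁v}(μ₁x − 1) if μ₁ = μ₂, and ρ(x,v) = e^{−μ₂v}(μ₂e^{−(μ₂−μ₁)x} − μ₁)/(μ₁ − μ₂) if μ₁ ≠ μ₂. Then the function (x,v) ↦ λe^{−λv} μ₁e^{−μ₁x} ρ(x,v)² is integrable over [0,∞)² if and only if μ₁ < 2μ₂. -/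
open MeasureTheory Real Set
open scoped Classical

theorem integrableOn_exp_mul_Ici_iff {a c : ℝ} :
    IntegrableOn (fun x : ℝ => Real.exp (a * x)) (Ici c) ↔ a < 0 := by
  refine ⟨fun h => ?_, fun ha =>
    (integrableOn_Ici_iff_integrableOn_Ioi).2 (integrableOn_exp_mul_Ioi ha c)⟩
  by_contra! ha
  have hconst : IntegrableOn (fun _ : ℝ => Real.exp (a * c)) (Ici c) := by
    refine Integrable.mono' h (by fun_prop) ?_
    filter_upwards [ae_restrict_mem measurableSet_Ici] with x hx
    rw [Real.norm_of_nonneg (Real.exp_nonneg _)]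
    exact Real.exp_le_exp.2 (mul_le_mul_of_nonneg_left hx ha)
  rw [integrableOn_const_iff] at hconst
  simp [Real.exp_ne_zero] at hconst

theorem integrableOn_pow_mul_exp_neg_mul_Ici (n : ℕ) {b : ℝ} (hb : 0 < b) :
    IntegrableOn (fun x : ℝ => x ^ n * Real.exp (-b * x)) (Ici 0) := by
  rw [integrableOn_Ici_iff_integrableOn_Ioi]
  have hn : (-1 : ℝ) < n := by linarith [n.cast_nonneg (α := ℝ)]
  simpa using integrableOn_rpow_mul_exp_neg_mul_rpow hn one_pos hb

theorem integrableOn_prod_mul_iff_left {α β : Type*} [MeasurableSpace α] [MeasurableSpace β]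
    {μ : Measure α} {ν : Measure β} [SFinite μ] [SFinite ν] {f : α → ℝ} {g : β → ℝ}
    {s : Set α} {t : Set β} (hg : IntegrableOn g t ν) (hg₀ : ∀ y, g y ≠ 0) (ht : ν t ≠ 0) :
    IntegrableOn (fun p : α × β => f p.1 * g p.2) (s ×ˢ t) (μ.prod ν) ↔ IntegrableOn f s μ := by
  rw [IntegrableOn, ← Measure.prod_restrict]
  refine ⟨fun h => ?_, fun hf => hf.mul_prod hg⟩
  have : (ae (ν.restrict t)).NeBot := by simpa [ae_neBot] using ht
  obtain ⟨y, hy⟩ := h.prod_left_ae.exists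
  exact (integrable_mul_const_iff (hg₀ y).isUnit f).1 hy

theorem integrableOn_exp_mul_sq_exp_sub_iff {μ₁ μ₂ : ℝ} (hμ₁ : 0 < μ₁) (hμ₂ : 0 < μ₂) :
    IntegrableOn (fun x : ℝ => Real.exp (-μ₁ * x) *
      (μ₂ * Real.exp (-(μ₂ - μ₁) * x) - μ₁) ^ 2) (Ici 0) ↔ μ₁ < 2 * μ₂ := by
  have hrest : IntegrableOn (fun x : ℝ => μ₁ ^ 2 * Real.exp (-μ₁ * x) -
      2 * μ₁ * μ₂ * Real.exp (-μ₂ * x)) (Ici 0) :=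
    ((integrableOn_exp_mul_Ici_iff.2 (neg_neg_of_pos hμ₁)).const_mul _).sub
      ((integrableOn_exp_mul_Ici_iff.2 (neg_neg_of_pos hμ₂)).const_mul _)
  have hexpand : (fun x : ℝ => Real.exp (-μ₁ * x) *
      (μ₂ * Real.exp (-(μ₂ - μ₁) * x) - μ₁) ^ 2) =
      (fun x : ℝ => μ₂ ^ 2 * Real.exp ((μ₁ - 2 * μ₂) * x)) +
        fun x : ℝ => μ₁ ^ 2 * Real.exp (-μ₁ * x) - 2 * μ₁ * μ₂ * Real.exp (-μ₂ * x) := by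
    funext x
    have h₁ : Real.exp ((μ₁ - 2 * μ₂) * x) =
        Real.exp (-μ₁ * x) * Real.exp (-(μ₂ - μ₁) * x) ^ 2 := by
      rw [← Real.exp_nat_mul, ← Real.exp_add]; push_cast; ring_nf
    have h₂ : Real.exp (-μ₂ * x) = Real.exp (-μ₁ * x) * Real.exp (-(μ₂ - μ₁) * x) := by
      rw [← Real.exp_add]; ring_nf
    simp only [Pi.add_apply, h₁, h₂]
    ring
  rw [hexpand, IntegrableOn, integrable_add_iff_integrable_left hrest,
    integrable_const_mul_iff (pow_ne_zero 2 hμ₂.ne').isUnit, ← IntegrableOn,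
    integrableOn_exp_mul_Ici_iff, sub_neg]

theorem integrableOn_exp_mul_sq_mul_sub_one {μ : ℝ} (hμ : 0 < μ) :
    IntegrableOn (fun x : ℝ => Real.exp (-μ * x) * (μ * x - 1) ^ 2) (Ici 0) := by
  have h := (((integrableOn_pow_mul_exp_neg_mul_Ici 2 hμ).const_mul (μ ^ 2)).sub
    ((integrableOn_pow_mul_exp_neg_mul_Ici 1 hμ).const_mul (2 * μ))).add
    (integrableOn_pow_mul_exp_neg_mul_Ici 0 hμ)
  refine h.congr (Filter.Eventually.of_forall fun x => ?_)
  simp only [Pi.add_apply, Pi.sub_apply]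
  ring

/-- For exponential service times with rates `μ₁` (Willie) and `μ₂`
(Alice) and Poisson arrival rate `λ`, the Fisher-information integrand
`λe^{−λv} μ₁e^{−μ₁x} ρ(x,v)²` is integrable over `[0,∞)²` iff `μ₁ < 2μ₂`. -/
theorem fisher_information_finite_iff
    (lam μ₁ μ₂ : ℝ) (hlam : 0 < lam) (hμ₁ : 0 < μ₁) (hμ₂ : 0 < μ₂) :
    IntegrableOn
      (fun p : ℝ × ℝ =>
        lam * Real.exp (-lam * p.2) * (μ₁ * Real.exp (-μ₁ * p.1)) *
          (if μ₁ = μ₂ then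
              Real.exp (-μ₁ * p.2) * (μ₁ * p.1 - 1)
            else
              Real.exp (-μ₂ * p.2) *
                (μ₂ * Real.exp (-(μ₂ - μ₁) * p.1) - μ₁) / (μ₁ - μ₂)) ^ 2)
      (Set.Ici (0:ℝ) ×ˢ Set.Ici (0:ℝ))
      ↔ μ₁ < 2 * μ₂ := by
  have hv (b c : ℝ) (hb : 0 < b) (hc : c ≠ 0) (f : ℝ → ℝ) :
      IntegrableOn (fun p : ℝ × ℝ => f p.1 *
        (c * Real.exp (-(lam + 2 * b) * p.2))) (Ici (0:ℝ) ×ˢ Ici (0:ℝ)) ↔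
        IntegrableOn f (Ici 0) :=
    integrableOn_prod_mul_iff_left
      ((integrableOn_exp_mul_Ici_iff.2 (by linarith)).const_mul c)
      (fun y => mul_ne_zero hc (Real.exp_ne_zero _)) (by simp)
  have hexp (b v : ℝ) : Real.exp (-(lam + 2 * b) * v) =
      Real.exp (-lam * v) * Real.exp (-b * v) ^ 2 := by
    rw [← Real.exp_nat_mul, ← Real.exp_add]; push_cast; ring_nf
  by_cases h : μ₁ = μ₂
  · subst h
    simp only [if_true]
    refine iff_of_true ?_ (by linarith)
    convert (hv μ₁ (lam * μ₁) hμ₁ (by positivity) _).2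
      (integrableOn_exp_mul_sq_mul_sub_one hμ₁) using 2 with p
    rw [hexp]
    ring
  · simp only [if_neg h]
    have hd : μ₁ - μ₂ ≠ 0 := sub_ne_zero.2 h
    rw [← integrableOn_exp_mul_sq_exp_sub_iff hμ₁ hμ₂,
      ← hv μ₂ (lam * μ₁ / (μ₁ - μ₂) ^ 2) hμ₂ (by positivity)]
    refine iff_of_eq (congrArg (IntegrableOn · _ _) (funext fun p => ?_))
    rw [hexp]
    field_simp
end

section
/- Fix μ > 0 and r = 2, and for θ ∈ [0,1/2) set ξ(θ) = θ/(1 − 2θ). Then, as θ → 0⁺, ∫₀^∞ 2μ e^{−2μx} √(Ξ(θ,x)) dx = 1 + (1/4)·ξ(θ)² log ξ(θ) + o(ξ(θ)² log ξ(θ)); that is, (∫₀^∞ 2μ e^{−2μx} √(Ξ(θ,x)) dx − 1 − (1/4)ξ(θ)² log ξ(θ))/(ξ(θ)² log ξ(θ)) → 0 as θ → 0⁺. -/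
open MeasureTheory Real Set Filter

/-- A primitive of `s ↦ 2 s² / (s² - 1)³` on `(1, ∞)`; substituting `s = √(1 + u)` turns it into a
primitive of `u ↦ √(1 + u) / u³`. -/
noncomputable def sqrtPrimitive (s : ℝ) : ℝ :=
  -s / (2 * (s ^ 2 - 1) ^ 2) - s / (4 * (s ^ 2 - 1)) - (Real.log (s - 1) - Real.log (s + 1)) / 8

theorem hasDerivAt_sqrtPrimitive {s : ℝ} (hs : 1 < s) :
    HasDerivAt sqrtPrimitive (2 * s ^ 2 / (s ^ 2 - 1) ^ 3) s := by
  have h1 : s - 1 ≠ 0 := by linarith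
  have h2 : s + 1 ≠ 0 := by linarith
  have h3 : s ^ 2 - 1 ≠ 0 := by nlinarith
  have hid := hasDerivAt_id s
  have hq : HasDerivAt (fun s : ℝ => s ^ 2 - 1) (2 * s) s := by
    simpa using (hid.pow 2).sub_const 1
  have ha := hid.neg.div ((hq.pow 2).const_mul 2) (mul_ne_zero two_ne_zero (pow_ne_zero 2 h3))
  have hb := hid.div (hq.const_mul 4) (mul_ne_zero four_ne_zero h3)
  have hc := (((hid.sub_const 1).log h1).sub ((hid.add_const 1).log h2)).div_const 8
  refine ((ha.sub hb).sub hc).congr_deriv ?_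
  have h4 : s ^ 2 - 1 = (s - 1) * (s + 1) := by ring
  simp only [Pi.pow_apply, Pi.neg_apply, id, h4]
  field_simp
  ring

theorem tendsto_sqrtPrimitive_atTop : Tendsto sqrtPrimitive atTop (nhds 0) := by
  have hm : Tendsto (fun s : ℝ => (s - 1)⁻¹) atTop (nhds 0) :=
    tendsto_inv_atTop_zero.comp (tendsto_atTop_add_const_right _ (-1) tendsto_id)
  have hp : Tendsto (fun s : ℝ => (s + 1)⁻¹) atTop (nhds 0) :=
    tendsto_inv_atTop_zero.comp (tendsto_atTop_add_const_right _ 1 tendsto_id)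
  have hl : Tendsto (fun s : ℝ => Real.log (1 - 2 * (s + 1)⁻¹)) atTop (nhds 0) := by
    have h : Tendsto (fun s : ℝ => 1 - 2 * (s + 1)⁻¹) atTop (nhds 1) := by
      simpa using (hp.const_mul 2).const_sub 1
    simpa using h.log one_ne_zero
  have h := (((((hm.add hp).mul (hm.mul hp)).mul_const (-1 / 4)).sub
    ((hm.add hp).mul_const (1 / 8))).sub (hl.div_const 8))
  simp only [add_zero, mul_zero, zero_mul, sub_zero, zero_div] at h
  refine h.congr' ?_
  filter_upwards [eventually_gt_atTop 1] with s hs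
  have h1 : s - 1 ≠ 0 := by linarith
  have h2 : s + 1 ≠ 0 := by linarith
  have h4 : s ^ 2 - 1 = (s - 1) * (s + 1) := by ring
  have h5 : 1 - 2 * (s + 1)⁻¹ = (s - 1) / (s + 1) := by field_simp; ring
  rw [sqrtPrimitive, h5, Real.log_div h1 h2, h4]
  field_simp
  ring

/-- The closed form of `∫₀^∞ 2μ e^{-2μx} √(1 + ξ e^{μx}) dx`. -/
theorem integral_exp_mul_sqrt_one_add {μ ξ : ℝ} (hμ : 0 < μ) (hξ : 0 < ξ) :
    ∫ x in Set.Ici (0:ℝ), 2 * μ * Real.exp (-(2 * μ) * x) * √(1 + ξ * Real.exp (μ * x)) =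
      √(1 + ξ) * (1 + ξ / 2) + ξ ^ 2 / 4 * Real.log ξ - ξ ^ 2 / 2 * Real.log (√(1 + ξ) + 1) := by
  have hs : ∀ y : ℝ, 0 < y → 1 < √(1 + y) := fun y hy => by
    rw [Real.lt_sqrt zero_le_one]; linarith
  have hderiv : ∀ x ∈ Ici (0:ℝ),
      HasDerivAt (fun x => 2 * ξ ^ 2 * sqrtPrimitive √(1 + ξ * Real.exp (μ * x)))
        (2 * μ * Real.exp (-(2 * μ) * x) * √(1 + ξ * Real.exp (μ * x))) x := by
    intro x _
    have hu : 0 < ξ * Real.exp (μ * x) := by positivity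
    have he : HasDerivAt (fun x => 1 + ξ * Real.exp (μ * x)) (ξ * (Real.exp (μ * x) * μ)) x := by
      simpa using ((((hasDerivAt_id x).const_mul μ).exp).const_mul ξ).const_add 1
    have h := (((hasDerivAt_sqrtPrimitive (hs _ hu)).comp x
      (he.sqrt (by positivity))).const_mul (2 * ξ ^ 2))
    refine h.congr_deriv ?_
    have hexp : Real.exp (-(2 * μ) * x) = (Real.exp (μ * x) ^ 2)⁻¹ := by
      rw [← Real.exp_nat_mul, ← Real.exp_neg]; congr 1; push_cast; ring
    have hsq : √(1 + ξ * Real.exp (μ * x)) ^ 2 = 1 + ξ * Real.exp (μ * x) :=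
      Real.sq_sqrt (by positivity)
    have hs0 : √(1 + ξ * Real.exp (μ * x)) ≠ 0 := by positivity
    have he0 : Real.exp (μ * x) ≠ 0 := (Real.exp_pos _).ne'
    have h3 : √(1 + ξ * Real.exp (μ * x)) ^ 2 - 1 = ξ * Real.exp (μ * x) := by rw [hsq]; ring
    rw [hexp, h3]
    field_simp
  have hlim : Tendsto (fun x => 2 * ξ ^ 2 * sqrtPrimitive √(1 + ξ * Real.exp (μ * x))) atTop
      (nhds 0) := by
    have h : Tendsto (fun x => √(1 + ξ * Real.exp (μ * x))) atTop atTop :=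
      Real.tendsto_sqrt_atTop.comp (tendsto_atTop_add_const_left _ 1
        ((Real.tendsto_exp_atTop.comp (tendsto_id.const_mul_atTop hμ)).const_mul_atTop hξ))
    simpa using (tendsto_sqrtPrimitive_atTop.comp h).const_mul (2 * ξ ^ 2)
  rw [integral_Ici_eq_integral_Ioi,
    integral_Ioi_of_hasDerivAt_of_nonneg' hderiv (fun x _ => by positivity) hlim]
  have h1 := hs ξ hξ
  have hsq : √(1 + ξ) ^ 2 = 1 + ξ := Real.sq_sqrt (by positivity)
  have hlog : Real.log ξ = Real.log (√(1 + ξ) - 1) + Real.log (√(1 + ξ) + 1) := by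
    rw [← Real.log_mul (by linarith) (by linarith)]
    congr 1
    linear_combination -hsq
  simp only [mul_zero, Real.exp_zero, mul_one, sqrtPrimitive, hsq, hlog, add_sub_cancel_left]
  field_simp
  ring

/-- For `μ > 0`, `r = 2` (so `Ξ(θ,x) = 1 + θ(e^{μx} − 2)`) and
`ξ(θ) = θ/(1−2θ)`, as `θ → 0⁺`,
`∫₀^∞ 2μ e^{−2μx} √Ξ(θ,x) dx = 1 + (1/4)ξ(θ)² log ξ(θ) + o(ξ(θ)² log ξ(θ))`. -/
theorem expansion_sqrt_Xi_r_eq_two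
    (μ : ℝ) (hμ : 0 < μ) :
    Filter.Tendsto
      (fun θ : ℝ =>
        ((∫ x in Set.Ici (0:ℝ),
            2 * μ * Real.exp (-(2 * μ) * x) *
              Real.sqrt (1 + θ * (Real.exp (μ * x) - 2)))
          - 1 - (1/4) * (θ / (1 - 2 * θ)) ^ 2 * Real.log (θ / (1 - 2 * θ)))
          / ((θ / (1 - 2 * θ)) ^ 2 * Real.log (θ / (1 - 2 * θ))))
      (nhdsWithin 0 (Set.Ioi 0)) (nhds 0) := by
  have hsmall : ∀ᶠ θ : ℝ in nhdsWithin 0 (Ioi 0), θ ∈ Ioo (0:ℝ) (1 / 4) :=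
    Ioo_mem_nhdsGT (by norm_num)
  have hξ : Tendsto (fun θ : ℝ => θ / (1 - 2 * θ)) (nhdsWithin 0 (Ioi 0)) (nhds 0) := by
    have h : ContinuousAt (fun θ : ℝ => θ / (1 - 2 * θ)) 0 := by
      fun_prop (disch := norm_num)
    simpa using h.tendsto.mono_left nhdsWithin_le_nhds
  have hc : Tendsto (fun θ : ℝ => 1 - 2 * θ) (nhdsWithin 0 (Ioi 0)) (nhds 1) := by
    have h : Continuous (fun θ : ℝ => 1 - 2 * θ) := by fun_prop
    simpa using (h.tendsto 0).mono_left nhdsWithin_le_nhds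
  have hlog : Tendsto (fun θ : ℝ => (Real.log (θ / (1 - 2 * θ)))⁻¹) (nhdsWithin 0 (Ioi 0))
      (nhds 0) := by
    refine tendsto_inv_atBot_zero.comp (Real.tendsto_log_nhdsGT_zero.comp ?_)
    refine tendsto_nhdsWithin_iff.2 ⟨hξ, ?_⟩
    filter_upwards [hsmall] with θ hθ
    exact div_pos hθ.1 (by linarith [hθ.2])
  have hsc : Tendsto (fun θ : ℝ => √(1 - 2 * θ)) (nhdsWithin 0 (Ioi 0)) (nhds 1) := by
    simpa using hc.sqrt
  have hs : Tendsto (fun θ : ℝ => √(1 + θ / (1 - 2 * θ))) (nhdsWithin 0 (Ioi 0)) (nhds 1) := by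
    simpa using (hξ.const_add 1).sqrt
  have hA := (hsc.mul hs).mul ((hξ.div_const 2).const_add 1)
  have hmain := ((((((hξ.div_const 4).const_add (5 / 4)).mul hc).div (hA.add_const 1)
    (by norm_num)).mul hlog).add ((hsc.sub_const 1).div_const 4)).sub
    (((hsc.div_const 2).mul ((hs.add_const 1).log (by norm_num))).mul hlog)
  simp only [mul_zero, sub_self, zero_div, add_zero, Pi.div_apply] at hmain
  refine hmain.congr' ?_
  filter_upwards [hsmall] with θ ⟨hθ0, hθ1⟩
  have hc0 : 0 < 1 - 2 * θ := by linarith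
  have hcne := hc0.ne'
  have hint : ∫ x in Set.Ici (0:ℝ), 2 * μ * Real.exp (-(2 * μ) * x) *
        √(1 + θ * (Real.exp (μ * x) - 2)) =
      √(1 - 2 * θ) * ∫ x in Set.Ici (0:ℝ), 2 * μ * Real.exp (-(2 * μ) * x) *
        √(1 + θ / (1 - 2 * θ) * Real.exp (μ * x)) := by
    rw [← integral_const_mul]
    congr 1 with x
    have h : 1 + θ * (Real.exp (μ * x) - 2) =
        (1 - 2 * θ) * (1 + θ / (1 - 2 * θ) * Real.exp (μ * x)) := by
      linear_combination -Real.exp (μ * x) * div_mul_cancel₀ θ hcne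
    rw [h, Real.sqrt_mul hc0.le]
    ring
  have hξ0 : 0 < θ / (1 - 2 * θ) := div_pos hθ0 hc0
  have hξ1 : θ / (1 - 2 * θ) < 1 := by rw [div_lt_one hc0]; linarith
  have hL : Real.log (θ / (1 - 2 * θ)) ≠ 0 := (Real.log_neg hξ0 hξ1).ne
  rw [hint, integral_exp_mul_sqrt_one_add hμ hξ0]
  have hcξ : (1 - 2 * θ) * (1 + 2 * (θ / (1 - 2 * θ))) = 1 := by field_simp; ring
  have hcsq := Real.sq_sqrt hc0.le
  have hssq := Real.sq_sqrt (show 0 ≤ 1 + θ / (1 - 2 * θ) by positivity)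
  have hcpos := Real.sqrt_pos.2 hc0
  have hspos := Real.sqrt_pos.2 (show 0 < 1 + θ / (1 - 2 * θ) by positivity)
  generalize √(1 + θ / (1 - 2 * θ)) = s at *
  generalize √(1 - 2 * θ) = d at *
  generalize θ / (1 - 2 * θ) = ξ at *
  generalize 1 - 2 * θ = c at *
  have hkey : (5 / 4 + ξ / 4) * c / (d * s * (1 + ξ / 2) + 1) =
      (d * s * (1 + ξ / 2) - 1) / ξ ^ 2 := by
    rw [div_eq_div_iff (by positivity) (by positivity)]
    have h : (d * s * (1 + ξ / 2)) ^ 2 = c * (1 + ξ) * (1 + ξ / 2) ^ 2 := by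
      rw [mul_pow, mul_pow, hcsq, hssq]
    linear_combination -h - hcξ
  rw [hkey]
  field_simp
  ring
end

section
/- Fix μ > 0 and r > 2, so that β = r/(r−1) ∈ (1,2). For θ ∈ [0,1/β) set ξ(θ) = (β−1)θ/(1 − βθ), and define I_β = β ∫₀^∞ (1 + t/2 − √(t+1))/t^{β+1} dt. Then 0 < I_β < ∞, and as θ → 0⁺, ∫₀^∞ μr e^{−μr x} √(Ξ(θ,x)) dx = 1 − I_β·ξ(θ)^β + o(ξ(θ)^β); that is, (∫₀^∞ μr e^{−μr x} √(Ξ(θ,x)) dx − 1 + I_β ξ(θ)^β)/ξ(θ)^β → 0 as θ → 0⁺. -/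
open MeasureTheory Real Set Filter

/-- The gap between `√(1 + t)` and its tangent line at `0` is positive for `t > 0`. -/
lemma sqrt_tangent_gap_pos {t : ℝ} (ht : 0 < t) : 0 < 1 + t / 2 - √(t + 1) := by
  have : √(t + 1) < 1 + t / 2 := by
    rw [Real.sqrt_lt' (by linarith)]
    nlinarith [sq_pos_of_pos ht]
  linarith

lemma sqrt_tangent_gap_le_half {t : ℝ} (ht : 0 ≤ t) : 1 + t / 2 - √(t + 1) ≤ t / 2 := by
  have : 1 ≤ √(t + 1) := Real.one_le_sqrt.2 (by linarith)
  linarith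

lemma sqrt_tangent_gap_le_sq {t : ℝ} (ht : 0 ≤ t) : 1 + t / 2 - √(t + 1) ≤ t ^ 2 := by
  have h1 : 1 ≤ √(t + 1) := Real.one_le_sqrt.2 (by linarith)
  have h2 : √(t + 1) ^ 2 = t + 1 := Real.sq_sqrt (by linarith)
  nlinarith [sq_nonneg (√(t + 1) - 1), mul_nonneg ht (sub_nonneg.2 h1)]

lemma integrableOn_sqrt_tangent_gap_div_rpow {β : ℝ} (h1 : 1 < β) (h2 : β < 2) :
    IntegrableOn (fun t : ℝ => (1 + t / 2 - √(t + 1)) / t ^ (β + 1)) (Ioi 0) := by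
  have hmeas : Measurable (fun t : ℝ => (1 + t / 2 - √(t + 1)) / t ^ (β + 1)) := by
    fun_prop
  rw [← Ioc_union_Ioi_eq_Ioi (zero_le_one' ℝ)]
  refine IntegrableOn.union ?_ ?_
  · have hI : IntegrableOn (fun t : ℝ => t ^ (1 - β)) (Ioc 0 1) :=
      (intervalIntegrable_iff_integrableOn_Ioc_of_le zero_le_one).1
        (intervalIntegral.intervalIntegrable_rpow' (by linarith))
    refine Integrable.mono' hI hmeas.aestronglyMeasurable ?_
    filter_upwards [ae_restrict_mem measurableSet_Ioc] with t ht
    have ht0 : 0 < t := ht.1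
    have hp : 0 < t ^ (β + 1) := Real.rpow_pos_of_pos ht0 _
    rw [Real.norm_of_nonneg (div_nonneg (sqrt_tangent_gap_pos ht0).le hp.le),
      div_le_iff₀ hp, ← Real.rpow_add ht0]
    have : t ^ (1 - β + (β + 1)) = t ^ 2 := by
      rw [← Real.rpow_two]; ring_nf
    rw [this]
    exact sqrt_tangent_gap_le_sq ht0.le
  · have hI : IntegrableOn (fun t : ℝ => t ^ (-β)) (Ioi 1) :=
      integrableOn_Ioi_rpow_of_lt (by linarith) one_pos
    refine Integrable.mono' hI hmeas.aestronglyMeasurable ?_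
    filter_upwards [ae_restrict_mem measurableSet_Ioi] with t ht
    have ht0 : 0 < t := one_pos.trans ht
    have hp : 0 < t ^ (β + 1) := Real.rpow_pos_of_pos ht0 _
    rw [Real.norm_of_nonneg (div_nonneg (sqrt_tangent_gap_pos ht0).le hp.le),
      div_le_iff₀ hp, ← Real.rpow_add ht0]
    have : t ^ (-β + (β + 1)) = t := by
      rw [neg_add_cancel_left, Real.rpow_one]
    rw [this]
    linarith [sqrt_tangent_gap_le_half ht0.le]

lemma integral_sqrt_tangent_gap_div_rpow_pos {β : ℝ} (h1 : 1 < β) (h2 : β < 2) :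
    0 < ∫ t in Ioi (0 : ℝ), (1 + t / 2 - √(t + 1)) / t ^ (β + 1) := by
  have hpos : ∀ t ∈ Ioi (0 : ℝ), 0 < (1 + t / 2 - √(t + 1)) / t ^ (β + 1) := fun t ht =>
    div_pos (sqrt_tangent_gap_pos ht) (Real.rpow_pos_of_pos ht _)
  rw [setIntegral_pos_iff_support_of_nonneg_ae
    (by filter_upwards [ae_restrict_mem measurableSet_Ioi] with t ht using (hpos t ht).le)
    (integrableOn_sqrt_tangent_gap_div_rpow h1 h2)]
  have hsub : Ioi (0 : ℝ) ⊆
      Function.support fun t : ℝ => (1 + t / 2 - √(t + 1)) / t ^ (β + 1) :=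
    fun t ht => (hpos t ht).ne'
  rw [inter_eq_right.2 hsub]
  simp

lemma image_mul_exp_Ioi {c ξ : ℝ} (hc : 0 < c) (hξ : 0 < ξ) :
    (fun x : ℝ => ξ * exp (c * x)) '' Ioi 0 = Ioi ξ := by
  ext y
  constructor
  · rintro ⟨x, hx, rfl⟩
    have : 1 < exp (c * x) := Real.one_lt_exp_iff.2 (mul_pos hc hx)
    exact lt_mul_of_one_lt_right hξ this
  · intro hy
    have h : 1 < y / ξ := (one_lt_div hξ).2 hy
    refine ⟨log (y / ξ) / c, div_pos (Real.log_pos h) hc, ?_⟩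
    simp only
    rw [mul_div_cancel₀ _ hc.ne', Real.exp_log (by linarith), mul_div_cancel₀ _ hξ.ne']

/-- Expectation of `√(1 + ξ U)` for a Pareto variable `U` of index `β`, written as the
exponential of an exponential variable. -/
lemma integral_exp_mul_sqrt_one_add_s8 {c β ξ : ℝ} (hc : 0 < c) (h1 : 1 < β) (h2 : β < 2)
    (hξ : 0 < ξ) :
    ∫ x in Ioi (0 : ℝ), c * β * exp (-(c * β) * x) * √(ξ * exp (c * x) + 1) =
      1 + ξ * β / (2 * (β - 1)) -
        β * ξ ^ β * ∫ t in Ioi ξ, (1 + t / 2 - √(t + 1)) / t ^ (β + 1) := by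
  set h : ℝ → ℝ := fun t => (1 + t / 2 - √(t + 1)) / t ^ (β + 1) with hdef
  set f : ℝ → ℝ := fun x => ξ * exp (c * x) with hf
  have hder : ∀ x ∈ Ioi (0 : ℝ), HasDerivWithinAt f (c * f x) (Ioi 0) x := by
    intro x _
    refine (((hasDerivAt_id x).const_mul c).exp.const_mul ξ).hasDerivWithinAt.congr_deriv ?_
    simp only [hf, id]
    ring
  have hinj : InjOn f (Ioi 0) := by
    intro x _ y _ hxy
    have := Real.exp_injective (mul_left_cancel₀ hξ.ne' hxy)
    exact mul_left_cancel₀ hc.ne' this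
  have himg : f '' Ioi 0 = Ioi ξ := image_mul_exp_Ioi hc hξ
  have hint : IntegrableOn (fun x => |c * f x| • h (f x)) (Ioi 0) := by
    rw [← integrableOn_image_iff_integrableOn_abs_deriv_smul measurableSet_Ioi hder hinj, himg]
    exact (integrableOn_sqrt_tangent_gap_div_rpow h1 h2).mono_set (Ioi_subset_Ioi hξ.le)
  have hval := integral_image_eq_integral_abs_deriv_smul measurableSet_Ioi hder hinj h
  rw [himg] at hval
  have hneg1 : -(c * β) < 0 := by nlinarith
  have hneg2 : -(c * (β - 1)) < 0 := by nlinarith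
  have hi1 := integrableOn_exp_mul_Ioi hneg1 0
  have hi2 := integrableOn_exp_mul_Ioi hneg2 0
  have hpt : ∀ x ∈ Ioi (0 : ℝ), c * β * exp (-(c * β) * x) * √(ξ * exp (c * x) + 1) =
      (c * β * exp (-(c * β) * x) + c * β * ξ / 2 * exp (-(c * (β - 1)) * x)) -
        β * ξ ^ β * (|c * f x| • h (f x)) := by
    intro x _
    have hfx : 0 < f x := mul_pos hξ (exp_pos _)
    have hpow : f x ^ (β + 1) = ξ ^ β * exp (c * β * x) * f x := by
      rw [Real.rpow_add_one hfx.ne', hf, Real.mul_rpow hξ.le (exp_pos _).le, ← Real.exp_mul]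
      ring_nf
    have hξβ : 0 < ξ ^ β := Real.rpow_pos_of_pos hξ _
    have he : exp (-(c * (β - 1)) * x) = exp (-(c * β) * x) * exp (c * x) := by
      rw [← Real.exp_add]; ring_nf
    have he' : exp (-(c * β) * x) = (exp (c * β * x))⁻¹ := by
      rw [← Real.exp_neg]; ring_nf
    have hE := exp_pos (c * β * x)
    have hsm : β * ξ ^ β * (|c * f x| • h (f x)) =
        c * β * exp (-(c * β) * x) * (1 + f x / 2 - √(f x + 1)) := by
      rw [abs_of_pos (mul_pos hc hfx), smul_eq_mul, hdef]
      simp only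
      rw [hpow, he']
      field_simp
    rw [hsm, he]
    simp only [hf]
    ring
  rw [setIntegral_congr_fun measurableSet_Ioi hpt,
    integral_sub (f := fun x => c * β * exp (-(c * β) * x) +
      c * β * ξ / 2 * exp (-(c * (β - 1)) * x)) ((hi1.const_mul _).add (hi2.const_mul _))
      (hint.const_mul _),
    integral_add (hi1.const_mul _) (hi2.const_mul _), integral_const_mul, integral_const_mul,
    integral_const_mul, ← hval, integral_exp_mul_Ioi hneg1, integral_exp_mul_Ioi hneg2]
  have hβ : β - 1 ≠ 0 := by linarith
  have hβ0 : β ≠ 0 := by linarith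
  simp only [mul_zero, exp_zero]
  field_simp

/-- Tail integrals over `Ioi ξ` converge to the integral over `Ioi 0` as `ξ → 0`. -/
lemma tendsto_setIntegral_Ioi {f : ℝ → ℝ} {g : ℝ → ℝ} {l : Filter ℝ}
    [l.IsCountablyGenerated] (hf : IntegrableOn f (Ioi 0)) (hg : Tendsto g l (nhds 0))
    (hpos : ∀ᶠ x in l, 0 < g x) :
    Tendsto (fun x => ∫ t in Ioi (g x), f t) l (nhds (∫ t in Ioi (0 : ℝ), f t)) := by
  refine ((aecover_Ioi_of_Ioi (μ := volume) hg).integral_tendsto_of_countably_generated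
    hf).congr' ?_
  filter_upwards [hpos] with x hx
  rw [Measure.restrict_restrict measurableSet_Ioi,
    inter_eq_left.2 (Ioi_subset_Ioi hx.le)]

/-- The remainder in the expansion of `√(1 - s) (1 + s / (2 (1 - s)))` is of second order. -/
lemma sqrt_mul_sub_one_eq {s : ℝ} (hs : s < 1) :
    √(1 - s) * (1 + s / (2 * (1 - s))) - 1 =
      s ^ 2 / (4 * √(1 - s) * (1 - s / 2 + √(1 - s))) := by
  obtain ⟨q, hq, hqs⟩ : ∃ q, 0 < q ∧ √(1 - s) = q := ⟨_, Real.sqrt_pos.2 (by linarith), rfl⟩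
  have hq2 : 1 - s = q ^ 2 := by rw [← hqs, Real.sq_sqrt (by linarith)]
  rw [hqs, hq2]
  have hs' : s = 1 - q ^ 2 := by linarith
  subst hs'
  have hden : 1 - (1 - q ^ 2) / 2 + q = (1 + q) ^ 2 / 2 := by ring
  rw [hden]
  field_simp
  ring

/-- For `μ > 0` and `r > 2` (so `β = r/(r−1) ∈ (1,2)`), with
`ξ(θ) = (β−1)θ/(1−βθ)` and `I_β = β∫₀^∞ (1 + t/2 − √(t+1))/t^{β+1} dt`, one has
`0 < I_β < ∞` and, as `θ → 0⁺`,
`∫₀^∞ μr e^{−μrx} √Ξ(θ,x) dx = 1 − I_β ξ(θ)^β + o(ξ(θ)^β)`. -/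
theorem expansion_sqrt_Xi_r_gt_two
    (μ r : ℝ) (hμ : 0 < μ) (hr : 2 < r) :
    IntegrableOn
      (fun t : ℝ => (1 + t / 2 - Real.sqrt (t + 1)) / t ^ (r / (r - 1) + 1))
      (Set.Ioi (0:ℝ)) ∧
    0 < (r / (r - 1)) *
        ∫ t in Set.Ioi (0:ℝ), (1 + t / 2 - Real.sqrt (t + 1)) / t ^ (r / (r - 1) + 1) ∧
    Filter.Tendsto
      (fun θ : ℝ =>
        ((∫ x in Set.Ici (0:ℝ),
            μ * r * Real.exp (-(μ * r) * x) *
              Real.sqrt (1 + θ * (Real.exp ((r - 1) * μ * x) / (r - 1) - r / (r - 1))))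
          - 1
          + ((r / (r - 1)) *
              ∫ t in Set.Ioi (0:ℝ),
                (1 + t / 2 - Real.sqrt (t + 1)) / t ^ (r / (r - 1) + 1)) *
            ((r / (r - 1) - 1) * θ / (1 - (r / (r - 1)) * θ)) ^ (r / (r - 1)))
          / ((r / (r - 1) - 1) * θ / (1 - (r / (r - 1)) * θ)) ^ (r / (r - 1)))
      (nhdsWithin 0 (Set.Ioi 0)) (nhds 0) := by
  obtain ⟨β, hβ⟩ : ∃ β, r / (r - 1) = β := ⟨_, rfl⟩
  have hr1 : 0 < r - 1 := by linarith
  have h1 : 1 < β := by rw [← hβ, one_lt_div hr1]; linarith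
  have h2 : β < 2 := by rw [← hβ, div_lt_iff₀ hr1]; linarith
  have hβ1 : 0 < β - 1 := by linarith
  have hβr : (r - 1) * β = r := by rw [← hβ]; field_simp
  have hinv : (r - 1)⁻¹ = β - 1 := by
    rw [← hβ]; field_simp; ring
  rw [hβ]
  have hint := integrableOn_sqrt_tangent_gap_div_rpow h1 h2
  refine ⟨hint, mul_pos (by linarith) (integral_sqrt_tangent_gap_div_rpow_pos h1 h2), ?_⟩
  set ξ : ℝ → ℝ := fun θ => (β - 1) * θ / (1 - β * θ) with hξ
  set J : ℝ → ℝ := fun a => ∫ t in Ioi a, (1 + t / 2 - √(t + 1)) / t ^ (β + 1) with hJ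
  have hcont : ContinuousAt ξ 0 := by
    refine ContinuousAt.div (by fun_prop) (by fun_prop) (by simp)
  have hξ0 : Tendsto ξ (nhdsWithin 0 (Ioi 0)) (nhds 0) := by
    have := hcont.tendsto.mono_left (nhdsWithin_le_nhds (s := Ioi 0))
    simpa [hξ] using this
  have hsmall : ∀ᶠ θ : ℝ in nhdsWithin 0 (Ioi 0), 0 < θ ∧ β * θ < 1 := by
    refine (eventually_mem_nhdsWithin).and ?_
    have : Tendsto (fun θ : ℝ => β * θ) (nhdsWithin 0 (Ioi 0)) (nhds 0) := by
      have : ContinuousAt (fun θ : ℝ => β * θ) 0 := by fun_prop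
      simpa using this.tendsto.mono_left (nhdsWithin_le_nhds (s := Ioi 0))
    exact this.eventually_lt_const one_pos
  have hξpos : ∀ᶠ θ in nhdsWithin 0 (Ioi 0), 0 < ξ θ := by
    filter_upwards [hsmall] with θ hθ
    exact div_pos (mul_pos hβ1 hθ.1) (by linarith [hθ.2])
  have hJlim := tendsto_setIntegral_Ioi hint hξ0 hξpos
  set K : ℝ → ℝ := fun θ =>
    ((1 - β * θ) * (β / (β - 1))) ^ 2 /
      (4 * √(1 - β * θ) * (1 - β * θ / 2 + √(1 - β * θ))) with hK
  have hKlim : Tendsto K (nhdsWithin 0 (Ioi 0)) (nhds (K 0)) := by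
    refine Tendsto.mono_left (ContinuousAt.tendsto ?_) nhdsWithin_le_nhds
    refine ContinuousAt.div (by fun_prop) (by fun_prop) (by norm_num)
  have hqlim : Tendsto (fun θ : ℝ => √(1 - β * θ)) (nhdsWithin 0 (Ioi 0)) (nhds 1) := by
    have : ContinuousAt (fun θ : ℝ => √(1 - β * θ)) 0 := by fun_prop
    simpa using this.tendsto.mono_left (nhdsWithin_le_nhds (s := Ioi 0))
  have hplim : Tendsto (fun θ => ξ θ ^ (2 - β)) (nhdsWithin 0 (Ioi 0)) (nhds 0) := by
    have := hξ0.rpow_const (p := 2 - β) (Or.inr (by linarith))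
    rwa [Real.zero_rpow (by linarith)] at this
  have hlim : Tendsto (fun θ => K θ * ξ θ ^ (2 - β) +
      β * (J 0 - √(1 - β * θ) * J (ξ θ))) (nhdsWithin 0 (Ioi 0)) (nhds 0) := by
    have := (hKlim.mul hplim).add (((tendsto_const_nhds (x := J 0)).sub
      (hqlim.mul hJlim)).const_mul β)
    simpa [hJ] using this
  refine hlim.congr' ?_
  filter_upwards [hsmall, hξpos] with θ hθ hξθ
  have hs : 0 < 1 - β * θ := by linarith [hθ.2]
  have hP : 0 < ξ θ ^ β := Real.rpow_pos_of_pos hξθ _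
  have hkey : ∫ x in Ici (0 : ℝ), μ * r * exp (-(μ * r) * x) *
      √(1 + θ * (exp ((r - 1) * μ * x) / (r - 1) - β)) =
      √(1 - β * θ) * (1 + β * θ / (2 * (1 - β * θ)) - β * ξ θ ^ β * J (ξ θ)) := by
    rw [integral_Ici_eq_integral_Ioi]
    have hc : 0 < (r - 1) * μ := mul_pos hr1 hμ
    have hcβ : (r - 1) * μ * β = μ * r := by rw [mul_right_comm, hβr, mul_comm]
    have hE := integral_exp_mul_sqrt_one_add_s8 hc h1 h2 hξθ
    rw [hcβ] at hE
    have hlin : ξ θ * β / (2 * (β - 1)) = β * θ / (2 * (1 - β * θ)) := by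
      simp only [hξ]; field_simp
    rw [← hlin, ← hE, ← integral_const_mul]
    congr 1
    ext x
    have hsplit : 1 + θ * (exp ((r - 1) * μ * x) / (r - 1) - β) =
        (1 - β * θ) * (ξ θ * exp ((r - 1) * μ * x) + 1) := by
      have hcancel : (1 - β * θ) * ξ θ = (β - 1) * θ := by
        simp only [hξ]; field_simp
      rw [div_eq_mul_inv, hinv]
      linear_combination -exp ((r - 1) * μ * x) * hcancel
    rw [hsplit, Real.sqrt_mul hs.le]
    ring
  have hrem := sqrt_mul_sub_one_eq hθ.2
  have hsξ : β * θ = (1 - β * θ) * (β / (β - 1)) * ξ θ := by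
    simp only [hξ]; field_simp
  have hKξ : (β * θ) ^ 2 / (4 * √(1 - β * θ) * (1 - β * θ / 2 + √(1 - β * θ))) =
      K θ * (ξ θ ^ (2 - β) * ξ θ ^ β) := by
    rw [← Real.rpow_add hξθ, sub_add_cancel, Real.rpow_two, hK]
    nth_rewrite 1 [hsξ]
    ring
  rw [hkey, eq_div_iff hP.ne']
  rw [hKξ] at hrem
  change _ = _ - 1 + β * J 0 * ξ θ ^ β
  linear_combination -hrem
end

section
/- Fix μ > 0 and r > 1, set β = r/(r−1), and let θ ∈ (0, 1/β). Then ∫₀^∞ μr e^{−μr x} √(Ξ(θ,x)) dx = (2β θ^β (β−1)^β/(1 − θβ)^{β−1/2}) · ∫_{√((1−θ)/(1−θβ))}^∞ t²/(t² − 1)^{β+1} dt. -/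
open MeasureTheory Real Set

/-- The map `x ↦ √(1 + a e^{kx})` sends `(0, ∞)` onto `(√(1 + a), ∞)`. -/
lemma image_sqrt_one_add_mul_exp_Ioi {a k : ℝ} (ha : 0 < a) (hk : 0 < k) :
    (fun x => √(1 + a * exp (k * x))) '' Ioi 0 = Ioi √(1 + a) := by
  ext t
  simp only [mem_image, mem_Ioi]
  constructor
  · rintro ⟨x, hx, rfl⟩
    refine sqrt_lt_sqrt (by positivity) ?_
    have : 1 < exp (k * x) := one_lt_exp_iff.2 (by positivity)
    nlinarith
  · intro ht
    have ht0 : 0 < t := (sqrt_nonneg _).trans_lt ht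
    have h : 1 + a < t ^ 2 := (sqrt_lt' ht0).1 ht
    have h1 : 1 < (t ^ 2 - 1) / a := by rw [lt_div_iff₀ ha]; linarith
    refine ⟨log ((t ^ 2 - 1) / a) / k, div_pos (log_pos h1) hk, ?_⟩
    rw [mul_div_cancel₀ _ hk.ne', exp_log (by linarith), mul_div_cancel₀ _ ha.ne']
    rw [add_sub_cancel, sqrt_sq ht0.le]

/-- The substitution `t = √(1 + a e^{kx})` in an integral over `(√(1 + a), ∞)`. -/
lemma integral_Ioi_sqrt_one_add {a k : ℝ} (ha : 0 < a) (hk : 0 < k) (g : ℝ → ℝ) :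
    ∫ t in Ioi √(1 + a), g t =
      ∫ x in Ioi 0, a * (exp (k * x) * k) / (2 * √(1 + a * exp (k * x))) *
        g √(1 + a * exp (k * x)) := by
  rw [← image_sqrt_one_add_mul_exp_Ioi ha hk,
    integral_image_eq_integral_deriv_smul_of_monotoneOn measurableSet_Ioi
      (f' := fun x => a * (exp (k * x) * k) / (2 * √(1 + a * exp (k * x))))]
  · simp only [smul_eq_mul]
  · intro x _
    refine HasDerivAt.hasDerivWithinAt (HasDerivAt.sqrt ?_ (by positivity))
    simpa using (((hasDerivAt_id x).const_mul k).exp.const_mul a).const_add 1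
  · intro x _ y _ hxy
    dsimp only
    gcongr

/-- For `μ > 0`, `r > 1`, `β = r/(r−1)`, and `θ ∈ (0, 1/β)`,
`∫₀^∞ μr e^{−μrx} √Ξ(θ,x) dx
  = (2β θ^β (β−1)^β/(1 − θβ)^{β−1/2}) ∫_{√((1−θ)/(1−θβ))}^∞ t²/(t²−1)^{β+1} dt`. -/
theorem integral_sqrt_Xi_eq
    (μ r : ℝ) (hμ : 0 < μ) (hr : 1 < r)
    (θ : ℝ) (hθ : θ ∈ Set.Ioo (0:ℝ) (1 / (r / (r - 1)))) :
    (∫ x in Set.Ici (0:ℝ),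
        μ * r * Real.exp (-(μ * r) * x) *
          Real.sqrt (1 + θ * (Real.exp ((r - 1) * μ * x) / (r - 1) - r / (r - 1))))
      = (2 * (r / (r - 1)) * θ ^ (r / (r - 1)) * (r / (r - 1) - 1) ^ (r / (r - 1))
            / (1 - θ * (r / (r - 1))) ^ (r / (r - 1) - 1/2)) *
          ∫ t in Set.Ioi (Real.sqrt ((1 - θ) / (1 - θ * (r / (r - 1))))),
            t ^ 2 / (t ^ 2 - 1) ^ (r / (r - 1) + 1) := by
  obtain ⟨hθ0, hθ1⟩ := hθ
  have hs : 0 < r - 1 := sub_pos.2 hr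
  have hr0 : 0 < r := by linarith
  set b := r / (r - 1) with hb
  have hb0 : 0 < b := by positivity
  have hbs : b * (r - 1) = r := div_mul_cancel₀ _ hs.ne'
  have hb1 : b - 1 = 1 / (r - 1) := by rw [hb]; field_simp; ring
  have hb1' : 0 < b - 1 := by rw [hb1]; positivity
  set c := 1 - θ * b with hc
  have hc0 : 0 < c := by
    rw [lt_div_iff₀ hb0] at hθ1
    linarith
  have ha : 0 < θ * (b - 1) / c := by positivity
  have h0 : (1 - θ) / c = 1 + θ * (b - 1) / c := by field_simp; rw [hc]; ring
  rw [h0, integral_Ioi_sqrt_one_add ha (mul_pos hs hμ), integral_Ici_eq_integral_Ioi,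
    ← integral_const_mul]
  refine integral_congr_ae (.of_forall fun x => ?_)
  dsimp only
  set E := exp ((r - 1) * μ * x) with hE
  have hE0 : 0 < E := exp_pos _
  have hXi : 1 + θ * (E / (r - 1) - b) = c * (1 + θ * (b - 1) / c * E) := by
    rw [hb1, hc]; rw [hc] at hc0; field_simp; ring
  set u := 1 + θ * (b - 1) / c * E with hu
  have hu0 : 0 < u := by positivity
  have hEb : exp (-(μ * r) * x) = (E ^ b)⁻¹ := by
    rw [hE, ← exp_mul, ← exp_neg]
    congr 1
    linear_combination (-μ * x) * (-hbs)
  have hu1 : u - 1 = θ * (b - 1) / c * E := by rw [hu]; ring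
  rw [hXi, sqrt_mul hc0.le, sq_sqrt hu0.le, hu1, rpow_add_one (by positivity),
    mul_rpow (by positivity) hE0.le, div_rpow (by positivity) hc0.le,
    mul_rpow hθ0.le hb1'.le, hEb, rpow_sub hc0, ← sqrt_eq_rpow]
  have hθb := rpow_pos_of_pos hθ0 b
  have hbb := rpow_pos_of_pos hb1' b
  have hcb := rpow_pos_of_pos hc0 b
  have hEb0 := rpow_pos_of_pos hE0 b
  have hsu := sqrt_pos.2 hu0
  have huu : u = √u * √u := (mul_self_sqrt hu0.le).symm
  generalize hv : √u = v at *
  rw [huu]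
  field_simp
  linear_combination -hbs
end

section
/- Let λ, μ₁, μ₂ > 0 with μ₁ < 2μ₂, set p = λ/(λ + μ₂) and p̄ = 1 − p, let π_J ∈ [0,1] with π̄_J = 1 − π_J, let S ≥ 1 be an integer and Q : {0,…,S} → [0,∞) with Σ_{s=0}^S Q(s) = 1, and let η ≥ 0. With g₁(x) = μ₁e^{−μ₁x} and h_s(x) = μ₂^s x^{s−1} e^{−μ₂x}/(s−1)!, define Φ₁(x) = p π_J (g₁*h₁)(x)/g₁(x) and Φ₂(x) = p π_J Σ_{s=2}^S ((g₁*h_s)(x)/g₁(x)) Σ_{l=s}^S Q(l) p̄^{l−s} + π̄_J Σ_{s=1}^S ((g₁*h_s)(x)/g₁(x)) Q(s). Then ∫₀^∞ μ₁ e^{−μ₁x} (ηΦ₁(x) + Φ₂(x))² dx < ∞. -/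
open MeasureTheory Real Set
open scoped BigOperators

/-- `s`-stage Erlang density with rate `μ₂` per stage. -/
noncomputable def erlangDensity (μ₂ : ℝ) (s : ℕ) (x : ℝ) : ℝ :=
  μ₂ ^ s * x ^ (s - 1) * Real.exp (-μ₂ * x) / (Nat.factorial (s - 1))

/-- Convolution `(g₁ * h_s)(x)` of the exponential density `g₁` (rate `μ₁`)
with the `s`-stage Erlang density `h_s` (rate `μ₂` per stage). -/
noncomputable def convExpErlang (μ₁ μ₂ : ℝ) (s : ℕ) (x : ℝ) : ℝ :=
  ∫ u in (0:ℝ)..x, (μ₁ * Real.exp (-μ₁ * u)) * erlangDensity μ₂ s (x - u)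

/-- `Φ₁(x) = p π_J (g₁*h₁)(x)/g₁(x)` with `p = λ/(λ+μ₂)`. -/
noncomputable def Phi1 (lam μ₁ μ₂ πJ : ℝ) (x : ℝ) : ℝ :=
  (lam / (lam + μ₂)) * πJ *
    (convExpErlang μ₁ μ₂ 1 x / (μ₁ * Real.exp (-μ₁ * x)))

/-- `Φ₂(x) = p π_J Σ_{s=2}^S ((g₁*h_s)(x)/g₁(x)) Σ_{l=s}^S Q(l) p̄^{l−s}
          + π̄_J Σ_{s=1}^S ((g₁*h_s)(x)/g₁(x)) Q(s)` with `p̄ = 1 − p`. -/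
noncomputable def Phi2 (lam μ₁ μ₂ πJ : ℝ) (S : ℕ) (Q : ℕ → ℝ) (x : ℝ) : ℝ :=
  (lam / (lam + μ₂)) * πJ *
      ∑ s ∈ Finset.Icc 2 S,
        (convExpErlang μ₁ μ₂ s x / (μ₁ * Real.exp (-μ₁ * x))) *
          ∑ l ∈ Finset.Icc s S, Q l * (1 - lam / (lam + μ₂)) ^ (l - s)
    + (1 - πJ) *
        ∑ s ∈ Finset.Icc 1 S,
          (convExpErlang μ₁ μ₂ s x / (μ₁ * Real.exp (-μ₁ * x))) * Q s

theorem convExpErlang_div_eq {μ₁ : ℝ} (μ₂ : ℝ) (s : ℕ) (hμ₁ : 0 < μ₁) (x : ℝ) :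
    convExpErlang μ₁ μ₂ s x / (μ₁ * exp (-μ₁ * x)) =
      ∫ v in (0 : ℝ)..x, exp (μ₁ * v) * erlangDensity μ₂ s v := by
  have hsub := intervalIntegral.integral_comp_sub_left (a := 0) (b := x)
    (fun v => exp (μ₁ * v) * erlangDensity μ₂ s v) x
  rw [sub_self, sub_zero] at hsub
  rw [← hsub, convExpErlang, ← intervalIntegral.integral_div]
  refine intervalIntegral.integral_congr fun u _ => ?_
  have hexp : exp (-μ₁ * u) = exp (-μ₁ * x) * exp (μ₁ * (x - u)) := by
    rw [← exp_add]
    congr 1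
    ring
  have := (exp_pos (-μ₁ * x)).ne'
  simp only [hexp]
  field_simp

theorem continuous_erlangDensity (μ₂ : ℝ) (s : ℕ) : Continuous (erlangDensity μ₂ s) := by
  unfold erlangDensity
  fun_prop

theorem continuous_convExpErlang_div {μ₁ μ₂ : ℝ} (s : ℕ) (hμ₁ : 0 < μ₁) :
    Continuous fun x => convExpErlang μ₁ μ₂ s x / (μ₁ * exp (-μ₁ * x)) := by
  simp only [convExpErlang_div_eq μ₂ s hμ₁]
  have := continuous_erlangDensity μ₂ s
  exact intervalIntegral.continuous_primitive
    (fun a b => Continuous.intervalIntegrable (by fun_prop) a b) 0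

theorem exp_mul_erlangDensity_le {μ₁ μ₂ c v : ℝ} (s : ℕ) (hμ₂ : 0 < μ₂)
    (hcμ : μ₁ - μ₂ < c) (hv : 0 ≤ v) :
    exp (μ₁ * v) * erlangDensity μ₂ s v ≤
      μ₂ ^ s / (c - (μ₁ - μ₂)) ^ (s - 1) * exp (c * v) := by
  set δ := c - (μ₁ - μ₂) with hδ
  have hδ0 : 0 < δ := sub_pos.mpr hcμ
  have hexp : exp (c * v) = exp (δ * v) * (exp (μ₁ * v) * exp (-μ₂ * v)) := by
    rw [← exp_add, ← exp_add]
    congr 1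
    rw [hδ]
    ring
  calc exp (μ₁ * v) * erlangDensity μ₂ s v
      = μ₂ ^ s / δ ^ (s - 1) * ((δ * v) ^ (s - 1) / (s - 1).factorial *
          (exp (μ₁ * v) * exp (-μ₂ * v))) := by
        rw [erlangDensity, mul_pow]
        field_simp
    _ ≤ μ₂ ^ s / δ ^ (s - 1) * exp (c * v) := by
        rw [hexp]
        gcongr
        exact pow_div_factorial_le_exp _ (by positivity) _

theorem convExpErlang_div_isBigO {μ₁ μ₂ c : ℝ} (s : ℕ) (hμ₁ : 0 < μ₁) (hμ₂ : 0 < μ₂)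
    (hc : 0 < c) (hcμ : μ₁ - μ₂ < c) :
    (fun x => convExpErlang μ₁ μ₂ s x / (μ₁ * exp (-μ₁ * x)))
      =O[Filter.atTop] fun x => exp (c * x) := by
  set K := μ₂ ^ s / (c - (μ₁ - μ₂)) ^ (s - 1)
  have hK : 0 ≤ K := div_nonneg (by positivity) (pow_nonneg (sub_pos.mpr hcμ).le _)
  refine Asymptotics.IsBigO.of_bound (K / c) ?_
  filter_upwards [Filter.eventually_ge_atTop 0] with x hx
  rw [convExpErlang_div_eq μ₂ s hμ₁, norm_of_nonneg (exp_pos _).le]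
  calc ‖∫ v in (0 : ℝ)..x, exp (μ₁ * v) * erlangDensity μ₂ s v‖
      ≤ ∫ v in (0 : ℝ)..x, K * exp (c * v) := by
        refine intervalIntegral.norm_integral_le_of_norm_le hx
          (Filter.Eventually.of_forall fun v hv => ?_)
          (Continuous.intervalIntegrable (by fun_prop) _ _)
        have hv0 : 0 ≤ v := hv.1.le
        rw [norm_of_nonneg (by unfold erlangDensity; positivity)]
        exact exp_mul_erlangDensity_le s hμ₂ hcμ hv0
    _ = K / c * (exp (c * x) - 1) := by
        rw [intervalIntegral.integral_const_mul,
          intervalIntegral.integral_comp_mul_left (fun y => exp y) hc.ne', integral_exp]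
        simp only [mul_zero, exp_zero, smul_eq_mul]
        ring
    _ ≤ K / c * exp (c * x) := by
        gcongr
        linarith

/-- If `μ₁ < 2μ₂`, then
`∫₀^∞ μ₁ e^{−μ₁x} (ηΦ₁(x) + Φ₂(x))² dx < ∞`. -/
theorem integrable_sq_Phi
    (lam μ₁ μ₂ : ℝ) (hlam : 0 < lam) (hμ₁ : 0 < μ₁) (hμ₂ : 0 < μ₂)
    (hμ : μ₁ < 2 * μ₂)
    (πJ : ℝ) (hπJ : πJ ∈ Set.Icc (0:ℝ) 1)
    (S : ℕ) (hS : 1 ≤ S)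
    (Q : ℕ → ℝ) (hQnonneg : ∀ s ≤ S, 0 ≤ Q s)
    (hQsum : ∑ s ∈ Finset.range (S + 1), Q s = 1)
    (η : ℝ) (hη : 0 ≤ η) :
    IntegrableOn
      (fun x : ℝ =>
        μ₁ * Real.exp (-μ₁ * x) *
          (η * Phi1 lam μ₁ μ₂ πJ x + Phi2 lam μ₁ μ₂ πJ S Q x) ^ 2)
      (Set.Ici (0:ℝ)) := by
  obtain ⟨c, hc, hcμ₁⟩ := exists_between
    (show max 0 (μ₁ - μ₂) < μ₁ / 2 from max_lt (by linarith) (by linarith))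
  obtain ⟨hc0, hcμ⟩ := max_lt_iff.mp hc
  have hO (s : ℕ) := convExpErlang_div_isBigO s hμ₁ hμ₂ hc0 hcμ
  have hC (s : ℕ) := continuous_convExpErlang_div (μ₂ := μ₂) s hμ₁
  have hΦ : (fun x => η * Phi1 lam μ₁ μ₂ πJ x + Phi2 lam μ₁ μ₂ πJ S Q x)
      =O[Filter.atTop] fun x => exp (c * x) := by
    unfold Phi1 Phi2
    refine (((hO 1).const_mul_left _).const_mul_left _).add
      (((Asymptotics.IsBigO.fun_sum fun s _ => ?_).const_mul_left _).add
        ((Asymptotics.IsBigO.fun_sum fun s _ => ?_).const_mul_left _))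
    all_goals
      simp only [mul_comm (convExpErlang _ _ _ _ / _)]
      exact (hO s).const_mul_left _
  have hcont : Continuous
      fun x => η * Phi1 lam μ₁ μ₂ πJ x + Phi2 lam μ₁ μ₂ πJ S Q x := by
    unfold Phi1 Phi2
    fun_prop
  rw [integrableOn_Ici_iff_integrableOn_Ioi]
  refine integrable_of_isBigO_exp_neg (b := μ₁ - 2 * c) (by linarith) (by fun_prop) ?_
  refine (((Asymptotics.isBigO_refl (fun x => exp (-μ₁ * x)) _).const_mul_left μ₁).mul
    (hΦ.pow 2)).congr_right fun x => ?_
  rw [← exp_nat_mul, ← exp_add]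
  congr 1
  push_cast
  ring
end

section
/- Fix μ > 0 and r ∈ (0,1), let p ∈ (0,1], and let φ : ℕ → (0,∞) satisfy lim_{n→∞} φ(n) = ∞ and lim_{n→∞} n/φ(n)² = ∞. Then lim_{n→∞} (∫₀^∞ μr e^{−μrx} √(Ξ(p/φ(n), x)) dx)ⁿ = 0. -/
open MeasureTheory Real Set Filter

lemma sqrt_le_one_add_half_sub_sq {t d : ℝ} (ht : 0 ≤ 1 + t) (htd : 1 + t ≤ d) :
    √(1 + t) ≤ 1 + t / 2 - 1 / (4 * (1 + d)) * t ^ 2 := by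
  set s := √(1 + t) with hs
  have hs0 : 0 ≤ s := Real.sqrt_nonneg _
  have hs2 : s ^ 2 = 1 + t := Real.sq_sqrt ht
  have htE : t = s ^ 2 - 1 := by linarith
  have hd : 0 < 4 * (1 + d) := by linarith
  have key : 1 / (4 * (1 + d)) * t ^ 2 ≤ (s - 1) ^ 2 / 2 := by
    rw [one_div, inv_mul_le_iff₀ hd]
    have h1 : (s + 1) ^ 2 ≤ 2 * (1 + d) := by nlinarith [sq_nonneg (s - 1)]
    have h2 : t ^ 2 = (s - 1) ^ 2 * (s + 1) ^ 2 := by rw [htE]; ring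
    rw [h2]
    nlinarith [mul_le_mul_of_nonneg_left h1 (sq_nonneg (s - 1))]
  nlinarith

/-- A quadratic in `exp ((r - 1) μ x)` integrated against the exponential law of rate `μ r`. -/
lemma integrableOn_and_integral_exp_quadratic {μ r : ℝ} (hμ : 0 < μ) (hr : r ∈ Set.Ioo (0:ℝ) 1)
    (A B C : ℝ) :
    IntegrableOn (fun x => μ * r * Real.exp (-(μ * r) * x) *
      (A + B * Real.exp ((r - 1) * μ * x) + C * Real.exp ((r - 1) * μ * x) ^ 2)) (Set.Ioi 0) ∧
    ∫ x in Set.Ioi (0:ℝ), μ * r * Real.exp (-(μ * r) * x) *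
      (A + B * Real.exp ((r - 1) * μ * x) + C * Real.exp ((r - 1) * μ * x) ^ 2) =
      A + B * r + C * (r / (2 - r)) := by
  obtain ⟨hr0, hr1⟩ := hr
  have ha : -(μ * r) < 0 := by nlinarith
  have hb : -μ < 0 := by linarith
  have hc : -(μ * (2 - r)) < 0 := by nlinarith
  have e : (fun x => μ * r * Real.exp (-(μ * r) * x) *
      (A + B * Real.exp ((r - 1) * μ * x) + C * Real.exp ((r - 1) * μ * x) ^ 2)) =
      fun x => (μ * r * A) * Real.exp (-(μ * r) * x) + (μ * r * B) * Real.exp (-μ * x) +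
        (μ * r * C) * Real.exp (-(μ * (2 - r)) * x) := by
    funext x
    have h1 : Real.exp (-μ * x) = Real.exp (-(μ * r) * x) * Real.exp ((r - 1) * μ * x) := by
      rw [← Real.exp_add]; ring_nf
    have h2 : Real.exp (-(μ * (2 - r)) * x) =
        Real.exp (-(μ * r) * x) * Real.exp ((r - 1) * μ * x) ^ 2 := by
      rw [← Real.exp_nat_mul, ← Real.exp_add]; push_cast; ring_nf
    rw [h1, h2]; ring
  have i1 := (integrableOn_exp_mul_Ioi ha 0).const_mul (μ * r * A)
  have i2 := (integrableOn_exp_mul_Ioi hb 0).const_mul (μ * r * B)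
  have i3 := (integrableOn_exp_mul_Ioi hc 0).const_mul (μ * r * C)
  have i12 : IntegrableOn (fun x => (μ * r * A) * Real.exp (-(μ * r) * x) +
      (μ * r * B) * Real.exp (-μ * x)) (Set.Ioi 0) := i1.add i2
  rw [e]
  refine ⟨i12.add i3, ?_⟩
  rw [integral_add i12 i3, integral_add i1 i2, integral_const_mul, integral_const_mul,
    integral_const_mul, integral_exp_mul_Ioi ha, integral_exp_mul_Ioi hb, integral_exp_mul_Ioi hc]
  have : 2 - r ≠ 0 := by linarith
  simp only [mul_zero, Real.exp_zero]
  field_simp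

lemma integral_sqrt_one_add_le {μ r θ : ℝ} (hμ : 0 < μ) (hr : r ∈ Set.Ioo (0:ℝ) 1)
    (hθ : θ ∈ Set.Icc (0:ℝ) 1) :
    ∫ x in Set.Ioi (0:ℝ), μ * r * Real.exp (-(μ * r) * x) *
      √(1 + θ * (Real.exp ((r - 1) * μ * x) / (r - 1) - r / (r - 1))) ≤
      1 - 1 / (4 * (1 + 1 / (1 - r))) * (r / (2 - r)) * θ ^ 2 := by
  obtain ⟨hr0, hr1⟩ := hr
  obtain ⟨hθ0, hθ1⟩ := hθ
  set c : ℝ := 1 / (4 * (1 + 1 / (1 - r))) with hc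
  have h1r : 0 < 1 - r := by linarith
  set d : ℝ := 1 / (1 - r) with hd
  have hd0 : 0 < d := by positivity
  have hdr : d * (1 - r) = 1 := by rw [hd]; field_simp
  have hdiv : ∀ y, y / (r - 1) = -(d * y) := fun y => by
    rw [hd, ← neg_sub 1 r]; field_simp
  obtain ⟨hint, hval⟩ := integrableOn_and_integral_exp_quadratic hμ ⟨hr0, hr1⟩
    (1 + θ * (r * d) / 2 - c * θ ^ 2 * (r * d) ^ 2)
    (-(θ * d / 2) + 2 * c * θ ^ 2 * r * d ^ 2) (-(c * θ ^ 2 * d ^ 2))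
  refine (integral_mono_of_nonneg (ae_of_all _ fun x => by positivity) hint ?_).trans
    (hval.trans_le (le_of_eq ?_))
  · refine (ae_restrict_iff' measurableSet_Ioi).2 (ae_of_all _ fun x hx => ?_)
    have hx : 0 < x := hx
    have hu0 := Real.exp_pos ((r - 1) * μ * x)
    have hu1 : Real.exp ((r - 1) * μ * x) ≤ 1 := by
      rw [Real.exp_le_one_iff]
      nlinarith [mul_pos h1r (mul_pos hμ hx)]
    dsimp only
    rw [hdiv, hdiv]
    set u := Real.exp ((r - 1) * μ * x)
    have hg1 : -1 ≤ -(d * u) - -(d * r) := by nlinarith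
    have hg2 : -(d * u) - -(d * r) ≤ d * r := by nlinarith
    refine mul_le_mul_of_nonneg_left ?_ (by positivity)
    refine (sqrt_le_one_add_half_sub_sq (d := d) (by nlinarith) ?_).trans (le_of_eq ?_)
    · nlinarith [mul_le_mul_of_nonneg_left hg2 hθ0,
        mul_le_mul_of_nonneg_right hθ1 (mul_pos hd0 hr0).le]
    · rw [← hc]; ring
  · have h2 : 2 - r ≠ 0 := by linarith
    rw [hd]
    field_simp
    ring

/-- For `μ > 0`, `r ∈ (0,1)`, `p ∈ (0,1]`, and `φ → ∞` with
`n/φ(n)² → ∞`, one has `(E[√Ξ(p/φ(n),X_r)])ⁿ → 0`. -/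
theorem affinity_power_tendsto_zero_r_lt_one
    (μ r : ℝ) (hμ : 0 < μ) (hr : r ∈ Set.Ioo (0:ℝ) 1)
    (p : ℝ) (hp : p ∈ Set.Ioc (0:ℝ) 1)
    (φ : ℕ → ℝ) (hφpos : ∀ n, 0 < φ n)
    (hφinf : Filter.Tendsto φ Filter.atTop Filter.atTop)
    (hratio : Filter.Tendsto (fun n : ℕ => (n : ℝ) / φ n ^ 2)
      Filter.atTop Filter.atTop) :
    Filter.Tendsto
      (fun n : ℕ =>
        (∫ x in Set.Ici (0:ℝ),
            μ * r * Real.exp (-(μ * r) * x) *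
              Real.sqrt (1 + (p / φ n) *
                (Real.exp ((r - 1) * μ * x) / (r - 1) - r / (r - 1)))) ^ n)
      Filter.atTop (nhds 0) := by
  obtain ⟨hp0, hp1⟩ := hp
  simp only [integral_Ici_eq_integral_Ioi]
  set k : ℝ := 1 / (4 * (1 + 1 / (1 - r))) * (r / (2 - r)) with hk
  have hk0 : 0 < k := by
    have h1 : 0 < 1 - r := by linarith [hr.2]
    have h2 : 0 < 2 - r := by linarith
    have h3 := hr.1
    positivity
  have hlim : Filter.Tendsto (fun n : ℕ => Real.exp (-(k * p ^ 2 * ((n : ℝ) / φ n ^ 2))))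
      Filter.atTop (nhds 0) :=
    Real.tendsto_exp_neg_atTop_nhds_zero.comp (hratio.const_mul_atTop (by positivity))
  have hμr : 0 ≤ μ * r := (mul_pos hμ hr.1).le
  have hnonneg : ∀ n, 0 ≤ ∫ x in Set.Ioi (0:ℝ), μ * r * Real.exp (-(μ * r) * x) *
      √(1 + (p / φ n) * (Real.exp ((r - 1) * μ * x) / (r - 1) - r / (r - 1))) :=
    fun n => integral_nonneg fun x => by positivity
  refine squeeze_zero' (Eventually.of_forall fun n => pow_nonneg (hnonneg n) n) ?_ hlim
  filter_upwards [hφinf.eventually_ge_atTop 1] with n hn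
  have hφ := hφpos n
  have hθ : p / φ n ∈ Set.Icc (0:ℝ) 1 :=
    ⟨by positivity, (div_le_one hφ).2 (hp1.trans hn)⟩
  have hle := (integral_sqrt_one_add_le hμ hr hθ).trans (Real.one_sub_le_exp_neg _)
  refine (pow_le_pow_left₀ (hnonneg n) hle n).trans (le_of_eq ?_)
  rw [← Real.exp_nat_mul, ← hk]
  congr 1
  ring
end

section
/- Fix μ > 0 and r = 2 (so Ξ(θ,x) = 1 + θ(e^{μx} − 2)), let p ∈ (0,1], and let φ : ℕ → (0,∞) satisfy lim_{n→∞} φ(n) = ∞, lim_{n→∞} φ(n)/√(n log n) = 0, and liminf_{n→∞} φ(n)/√n > 0. Then lim_{n→∞} (∫₀^∞ 2μ e^{−2μx} √(Ξ(p/φ(n), x)) dx)ⁿ = 0. -/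
open MeasureTheory Real Set Filter

/-- A quadratic improvement of `√(1 + t) ≤ 1 + t / 2` near the origin. -/
theorem sqrt_one_add_le_sub_sq {t : ℝ} (h₁ : -1 ≤ t) (h₂ : t ≤ 1) :
    √(1 + t) ≤ 1 + t / 2 - t ^ 2 / 16 := by
  apply Real.sqrt_le_iff.2
  constructor
  · nlinarith
  · nlinarith [sq_nonneg (t ^ 2), mul_nonneg (sq_nonneg t) (sub_nonneg.2 h₂)]

theorem sqrt_one_add_le_add_half {t : ℝ} (h₁ : -1 ≤ t) : √(1 + t) ≤ 1 + t / 2 := by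
  apply Real.sqrt_le_iff.2
  constructor
  · linarith
  · nlinarith [sq_nonneg t]

theorem integral_exp_neg_mul_Ioi {a : ℝ} (ha : 0 < a) :
    ∫ x in Set.Ioi (0 : ℝ), Real.exp (-a * x) = 1 / a := by
  rw [integral_exp_mul_Ioi (neg_lt_zero.2 ha)]
  simp

/-- The Hellinger affinity at insertion probability `θ` falls below `1` by at least a multiple of
`θ² log (1 / θ)`. -/
theorem affinity_le_one_sub {μ θ : ℝ} (hμ : 0 < μ) (hθ : 0 < θ) (hθ' : 4 * θ ≤ 1) :
    ∫ x in Set.Ici (0 : ℝ), 2 * μ * Real.exp (-(2 * μ) * x) *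
        √(1 + θ * (Real.exp (μ * x) - 2)) ≤ 1 - θ ^ 2 / 32 * Real.log (1 / (4 * θ)) := by
  rw [integral_Ici_eq_integral_Ioi]
  set a := Real.log 4 / μ with ha
  set b := Real.log (1 / θ) / μ with hb
  have ha0 : 0 ≤ a := div_nonneg (Real.log_nonneg (by norm_num)) hμ.le
  have hab : a ≤ b := by
    apply div_le_div_of_nonneg_right _ hμ.le
    apply Real.log_le_log (by norm_num)
    rw [le_div_iff₀ hθ]
    exact hθ'
  have hba : μ * (b - a) = Real.log (1 / (4 * θ)) := by
    have : 1 / (4 * θ) = (1 / θ) / 4 := by field_simp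
    rw [this, Real.log_div (by positivity) (by norm_num), ha, hb]
    field_simp
  let g : ℝ → ℝ := fun x =>
    2 * μ * (1 - θ) * Real.exp (-(2 * μ) * x) + μ * θ * Real.exp (-μ * x)
  let k : ℝ → ℝ := (Set.Ioc a b).indicator fun _ => μ * θ ^ 2 / 32
  have h2 : IntegrableOn (fun x => 2 * μ * (1 - θ) * Real.exp (-(2 * μ) * x)) (Set.Ioi 0) :=
    (exp_neg_integrableOn_Ioi 0 (by positivity)).const_mul _
  have h1 : IntegrableOn (fun x => μ * θ * Real.exp (-μ * x)) (Set.Ioi 0) :=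
    (exp_neg_integrableOn_Ioi 0 hμ).const_mul _
  have hg : IntegrableOn g (Set.Ioi 0) := h2.add h1
  have hk : IntegrableOn k (Set.Ioi 0) := by
    apply Integrable.integrableOn
    exact (integrable_indicator_iff measurableSet_Ioc).2
      (integrableOn_const (by simp))
  have hgi : ∫ x in Set.Ioi (0 : ℝ), g x = 1 := by
    rw [integral_add h2 h1, integral_const_mul, integral_const_mul,
      integral_exp_neg_mul_Ioi hμ, integral_exp_neg_mul_Ioi (by positivity)]
    field_simp
    ring
  have hki : ∫ x in Set.Ioi (0 : ℝ), k x = θ ^ 2 / 32 * Real.log (1 / (4 * θ)) := by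
    have hsub : Set.Ioi (0 : ℝ) ∩ Set.Ioc a b = Set.Ioc a b :=
      Set.inter_eq_right.2 fun x hx => lt_of_le_of_lt ha0 hx.1
    rw [setIntegral_indicator measurableSet_Ioc, hsub, setIntegral_const, Measure.real,
      Real.volume_Ioc, ENNReal.toReal_ofReal (sub_nonneg.2 hab), ← hba, smul_eq_mul]
    ring
  have hmono : ∫ x in Set.Ioi (0 : ℝ), 2 * μ * Real.exp (-(2 * μ) * x) *
      √(1 + θ * (Real.exp (μ * x) - 2)) ≤ ∫ x in Set.Ioi (0 : ℝ), (g x - k x) := by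
    apply integral_mono_of_nonneg
    · exact Filter.Eventually.of_forall fun x => by positivity
    · exact hg.sub hk
    · filter_upwards [ae_restrict_mem measurableSet_Ioi] with x hx
      have hx0 : 0 < x := hx
      set u := Real.exp (μ * x) with hu
      set v := Real.exp (-μ * x) with hv
      have huv : u * v = 1 := by
        rw [hu, hv, ← Real.exp_add]
        simp
      have hvv : Real.exp (-(2 * μ) * x) = v ^ 2 := by
        rw [hv, ← Real.exp_nat_mul]
        congr 1
        push_cast
        ring
      have hu1 : 1 ≤ u := Real.one_le_exp (by positivity)
      have hv0 : 0 < v := Real.exp_pos _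
      have ht : -1 ≤ θ * (u - 2) := by nlinarith
      have hgx : g x = 2 * μ * v ^ 2 * (1 + θ * (u - 2) / 2) := by
        simp only [g, hvv, ← hv]
        linear_combination (-(μ * θ * v)) * huv
      rw [hvv, hgx]
      by_cases hxab : x ∈ Set.Ioc a b
      · have hu4 : 4 ≤ u := by
          rw [hu, ← Real.log_le_iff_le_exp (by norm_num), mul_comm]
          exact (div_le_iff₀ hμ).1 hxab.1.le
        have huθ : θ * u ≤ 1 := by
          have : u ≤ 1 / θ := by
            rw [hu, ← Real.le_log_iff_exp_le (by positivity), mul_comm]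
            exact (le_div_iff₀ hμ).1 hxab.2
          rw [mul_comm]
          exact (le_div_iff₀ hθ).1 this
        have hs := sqrt_one_add_le_sub_sq ht (by nlinarith)
        have hsq : u ^ 2 / 4 ≤ (u - 2) ^ 2 := by nlinarith
        have hone : v ^ 2 * (u ^ 2 / 4) = 1 / 4 := by
          linear_combination (u * v + 1) / 4 * huv
        have hlow : 1 / 4 ≤ v ^ 2 * (u - 2) ^ 2 :=
          hone ▸ mul_le_mul_of_nonneg_left hsq (sq_nonneg v)
        have hkx : k x = μ * θ ^ 2 / 32 := Set.indicator_of_mem hxab _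
        rw [hkx]
        calc 2 * μ * v ^ 2 * √(1 + θ * (u - 2))
            ≤ 2 * μ * v ^ 2 * (1 + θ * (u - 2) / 2 - (θ * (u - 2)) ^ 2 / 16) := by gcongr
          _ = 2 * μ * v ^ 2 * (1 + θ * (u - 2) / 2) -
                μ * θ ^ 2 / 8 * (v ^ 2 * (u - 2) ^ 2) := by ring
          _ ≤ 2 * μ * v ^ 2 * (1 + θ * (u - 2) / 2) - μ * θ ^ 2 / 8 * (1 / 4) := by gcongr
          _ = _ := by ring
      · have hkx : k x = 0 := Set.indicator_of_notMem hxab _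
        rw [hkx, sub_zero]
        exact mul_le_mul_of_nonneg_left (sqrt_one_add_le_add_half ht) (by positivity)
  rwa [integral_sub hg hk, hgi, hki] at hmono

theorem affinity_nonneg {μ θ : ℝ} (hμ : 0 < μ) :
    0 ≤ ∫ x in Set.Ici (0 : ℝ), 2 * μ * Real.exp (-(2 * μ) * x) *
        √(1 + θ * (Real.exp (μ * x) - 2)) :=
  integral_nonneg fun x => by positivity

/-- For `μ > 0`, `r = 2` (so `Ξ(θ,x) = 1 + θ(e^{μx} − 2)`),
`p ∈ (0,1]`, and `φ → ∞` with `φ(n)/√(n log n) → 0` and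
`liminf φ(n)/√n > 0` (i.e. eventually `φ(n)/√n ≥ c` for some `c > 0`),
one has `(E[√Ξ(p/φ(n),X₂)])ⁿ → 0`. -/
theorem affinity_power_tendsto_zero_r_eq_two
    (μ : ℝ) (hμ : 0 < μ)
    (p : ℝ) (hp : p ∈ Set.Ioc (0:ℝ) 1)
    (φ : ℕ → ℝ) (hφpos : ∀ n, 0 < φ n)
    (hφinf : Filter.Tendsto φ Filter.atTop Filter.atTop)
    (hupper : Filter.Tendsto
      (fun n : ℕ => φ n / Real.sqrt ((n : ℝ) * Real.log n))
      Filter.atTop (nhds 0))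
    (hlower : ∃ c : ℝ, 0 < c ∧
      ∀ᶠ n : ℕ in Filter.atTop, c ≤ φ n / Real.sqrt (n : ℝ)) :
    Filter.Tendsto
      (fun n : ℕ =>
        (∫ x in Set.Ici (0:ℝ),
            2 * μ * Real.exp (-(2 * μ) * x) *
              Real.sqrt (1 + (p / φ n) * (Real.exp (μ * x) - 2))) ^ n)
      Filter.atTop (nhds 0) := by
  obtain ⟨hp0, hp1⟩ := hp
  obtain ⟨c, hc, hlow⟩ := hlower
  have hratio : Tendsto (fun n : ℕ => (φ n / √((n : ℝ) * Real.log n))⁻¹) atTop atTop := by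
    apply Tendsto.inv_tendsto_nhdsGT_zero
    refine tendsto_nhdsWithin_iff.2 ⟨hupper, ?_⟩
    filter_upwards [eventually_gt_atTop 1] with n hn
    have hn' : (1 : ℝ) < n := by exact_mod_cast hn
    have := Real.log_pos hn'
    have := hφpos n
    exact Set.mem_Ioi.2 (by positivity)
  have hexp : Tendsto (fun n : ℕ => Real.exp
      (-(p ^ 2 / 128 * ((φ n / √((n : ℝ) * Real.log n))⁻¹) ^ 2))) atTop (nhds 0) :=
    Real.tendsto_exp_neg_atTop_nhds_zero.comp
      (((tendsto_pow_atTop two_ne_zero).comp hratio).const_mul_atTop (by positivity))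
  have hlog : Tendsto (fun n : ℕ => Real.log n) atTop atTop :=
    Real.tendsto_log_atTop.comp tendsto_natCast_atTop_atTop
  refine squeeze_zero' (Eventually.of_forall fun n => pow_nonneg (affinity_nonneg hμ) n) ?_ hexp
  filter_upwards [hlow, hφinf.eventually_ge_atTop 4, eventually_gt_atTop 1,
    hlog.eventually_ge_atTop (-4 * Real.log (c / 4))] with n hn hφ4 hn1 hlogn
  have hn' : (1 : ℝ) < n := by exact_mod_cast hn1
  have hlogpos := Real.log_pos hn'
  have hφn := hφpos n
  have hθ : 0 < p / φ n := by positivity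
  have hθ' : 4 * (p / φ n) ≤ 1 := by
    rw [← mul_div_assoc, div_le_one hφn]
    linarith
  have hJ := affinity_le_one_sub hμ hθ hθ'
  have hlogθ : Real.log n / 4 ≤ Real.log (1 / (4 * (p / φ n))) := by
    have hle : c / 4 * √(n : ℝ) ≤ 1 / (4 * (p / φ n)) := by
      have h₁ : c * √(n : ℝ) ≤ φ n := (le_div_iff₀ (by positivity)).1 hn
      have h₂ : 1 / (4 * (p / φ n)) = φ n / (4 * p) := by field_simp
      rw [h₂, le_div_iff₀ (by positivity)]
      nlinarith
    have h := Real.log_le_log (by positivity) hle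
    rw [Real.log_mul (by positivity) (by positivity), Real.log_sqrt (by positivity)] at h
    linarith
  have hbase := hJ.trans (Real.one_sub_le_exp_neg _)
  refine (pow_le_pow_left₀ (affinity_nonneg hμ) hbase n).trans ?_
  rw [← Real.exp_nat_mul]
  apply Real.exp_le_exp.2
  rw [mul_neg, neg_le_neg_iff, inv_div, div_pow, Real.sq_sqrt (by positivity)]
  calc p ^ 2 / 128 * (n * Real.log n / φ n ^ 2)
      = n * ((p / φ n) ^ 2 / 32 * (Real.log n / 4)) := by
        field_simp
        ring
    _ ≤ _ := by gcongr
end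

section
/- Fix μ > 0 and r > 2, set β = r/(r−1) ∈ (1,2), let p ∈ (0,1], and let φ : ℕ → (0,∞) satisfy lim_{n→∞} φ(n) = ∞ and lim_{n→∞} φ(n)/n^{1/β} = 0. Then lim_{n→∞} (∫₀^∞ μr e^{−μrx} √(Ξ(p/φ(n), x)) dx)ⁿ = 0. -/
open MeasureTheory Real Set Filter

/-- The tangent-line bound `√(1 + u) ≤ 1 + u / 2` has a uniform gap for `u ≥ 1`. -/
theorem sqrt_one_add_le_sub_of_one_le {u : ℝ} (hu : 1 ≤ u) :
    √(1 + u) ≤ 1 + u / 2 - 1 / 20 :=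
  Real.sqrt_le_iff.mpr ⟨by linarith, by nlinarith⟩

/-- A single-sample affinity bound: it falls below `1` by at least a multiple of `θ ^ (r / (r - 1))`. -/
theorem integral_exp_neg_mul_sqrt_le {μ r θ : ℝ} (hμ : 0 < μ) (hr : 1 < r)
    (hθ : 0 < θ) (hθ1 : θ ≤ 1) :
    ∫ x in Set.Ici (0:ℝ), μ * r * Real.exp (-(μ * r) * x) *
        √(1 + θ * (Real.exp ((r - 1) * μ * x) / (r - 1) - r / (r - 1)))
      ≤ 1 - ((2 * r - 1) / θ) ^ (-(r / (r - 1))) / 20 := by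
  have hr1 : 0 < r - 1 := by linarith
  have ha : 0 < μ * r := by positivity
  have hK : 1 ≤ (2 * r - 1) / θ := by rw [le_div_iff₀ hθ]; linarith
  set T := Real.log ((2 * r - 1) / θ) / ((r - 1) * μ) with hT
  have hT0 : 0 ≤ T := div_nonneg (Real.log_nonneg hK) (by positivity)
  have hexpT : Real.exp ((r - 1) * μ * T) = (2 * r - 1) / θ := by
    rw [hT, mul_div_cancel₀ _ (by positivity), Real.exp_log (by linarith)]
  have htail : Real.exp (-(μ * r) * T) = ((2 * r - 1) / θ) ^ (-(r / (r - 1))) := by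
    rw [Real.rpow_def_of_pos (by linarith), hT]
    congr 1
    field_simp
  have hia : IntegrableOn (fun x ↦ Real.exp (-(μ * r) * x)) (Set.Ioi 0) :=
    integrableOn_exp_mul_Ioi (by linarith) 0
  have hiμ : IntegrableOn (fun x ↦ Real.exp (-μ * x)) (Set.Ioi 0) :=
    integrableOn_exp_mul_Ioi (by linarith) 0
  have hit : IntegrableOn ((Set.Ioi T).indicator fun x ↦ Real.exp (-(μ * r) * x)) (Set.Ioi 0) :=
    hia.indicator measurableSet_Ioi
  rw [integral_Ici_eq_integral_Ioi, ← htail]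
  set c₁ := μ * r * (1 - θ / 2 * (r / (r - 1)))
  set c₂ := μ * r * (θ / 2 / (r - 1))
  have hI : Integrable (fun x ↦ c₁ * Real.exp (-(μ * r) * x) + c₂ * Real.exp (-μ * x))
      (volume.restrict (Set.Ioi 0)) := (hia.const_mul c₁).add (hiμ.const_mul c₂)
  calc _ ≤ ∫ x in Set.Ioi (0:ℝ), (c₁ * Real.exp (-(μ * r) * x) + c₂ * Real.exp (-μ * x)
        - μ * r / 20 * (Set.Ioi T).indicator (fun x ↦ Real.exp (-(μ * r) * x)) x) := by
        refine integral_mono_of_nonneg (ae_of_all _ fun x ↦ by positivity)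
          (hI.sub (hit.const_mul _)) (ae_restrict_of_forall_mem measurableSet_Ioi fun x hx ↦ ?_)
        have hx0 : (0:ℝ) < x := hx
        have hexp : Real.exp (-μ * x) = Real.exp (-(μ * r) * x) * Real.exp ((r - 1) * μ * x) := by
          rw [← Real.exp_add]; congr 1; ring
        set u := θ * (Real.exp ((r - 1) * μ * x) / (r - 1) - r / (r - 1)) with hu
        have hsplit : c₁ * Real.exp (-(μ * r) * x) + c₂ * Real.exp (-μ * x)
            = μ * r * Real.exp (-(μ * r) * x) * (1 + u / 2) := by
          rw [hexp, hu]; ring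
        have hw : 0 < μ * r * Real.exp (-(μ * r) * x) := by positivity
        simp only
        rw [hsplit]
        by_cases hxT : x ∈ Set.Ioi T
        · have hge : (2 * r - 1) / θ ≤ Real.exp ((r - 1) * μ * x) := by
            rw [← hexpT]
            exact Real.exp_le_exp.mpr (mul_le_mul_of_nonneg_left (le_of_lt hxT) (by positivity))
          have hu1 : 1 ≤ u := by
            rw [hu, ← sub_div, ← mul_div_assoc, le_div_iff₀ hr1]
            have := (div_le_iff₀ hθ).mp hge
            nlinarith
          rw [Set.indicator_of_mem hxT]
          have := mul_le_mul_of_nonneg_left (sqrt_one_add_le_sub_of_one_le hu1) hw.le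
          linarith
        · rw [Set.indicator_of_notMem hxT]
          have hu1 : -1 ≤ u := by
            have h1 : 1 ≤ Real.exp ((r - 1) * μ * x) := Real.one_le_exp (by positivity)
            rw [hu, ← sub_div, ← mul_div_assoc, le_div_iff₀ hr1]
            nlinarith
          have := mul_le_mul_of_nonneg_left (Real.sqrt_one_add_le hu1) hw.le
          linarith
    _ = 1 - Real.exp (-(μ * r) * T) / 20 := by
        have hr0 : r ≠ 0 := by positivity
        rw [integral_sub hI (hit.const_mul _),
          integral_add (hia.const_mul c₁) (hiμ.const_mul c₂)]
        simp only [integral_const_mul]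
        rw [setIntegral_indicator measurableSet_Ioi, Set.Ioi_inter_Ioi, sup_eq_right.mpr hT0,
          integral_exp_mul_Ioi (by linarith), integral_exp_mul_Ioi (by linarith),
          integral_exp_mul_Ioi (by linarith)]
        simp only [mul_zero, Real.exp_zero, c₁, c₂]
        field_simp
        ring

/-- For `μ > 0`, `r > 2` with `β = r/(r−1) ∈ (1,2)`, `p ∈ (0,1]`,
and `φ → ∞` with `φ(n)/n^{1/β} → 0`, one has `(E[√Ξ(p/φ(n),X_r)])ⁿ → 0`. -/
theorem affinity_power_tendsto_zero_r_gt_two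
    (μ r : ℝ) (hμ : 0 < μ) (hr : 2 < r)
    (p : ℝ) (hp : p ∈ Set.Ioc (0:ℝ) 1)
    (φ : ℕ → ℝ) (hφpos : ∀ n, 0 < φ n)
    (hφinf : Filter.Tendsto φ Filter.atTop Filter.atTop)
    (hratio : Filter.Tendsto
      (fun n : ℕ => φ n / (n : ℝ) ^ (1 / (r / (r - 1))))
      Filter.atTop (nhds 0)) :
    Filter.Tendsto
      (fun n : ℕ =>
        (∫ x in Set.Ici (0:ℝ),
            μ * r * Real.exp (-(μ * r) * x) *
              Real.sqrt (1 + (p / φ n) *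
                (Real.exp ((r - 1) * μ * x) / (r - 1) - r / (r - 1)))) ^ n)
      Filter.atTop (nhds 0) := by
  have hr1 : 0 < r - 1 := by linarith
  have hβ : 0 < r / (r - 1) := by positivity
  obtain ⟨hp0, hp1⟩ := hp
  set β := r / (r - 1)
  have hK : 0 < (2 * r - 1) / p := div_pos (by linarith) hp0
  have hbase : Tendsto (fun n : ℕ ↦ (2 * r - 1) / p * (φ n / (n : ℝ) ^ (1 / β)))
      atTop (nhdsWithin 0 (Set.Ioi 0)) := by
    refine tendsto_nhdsWithin_iff.mpr ⟨by simpa using hratio.const_mul ((2 * r - 1) / p), ?_⟩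
    filter_upwards [eventually_gt_atTop 0] with n hn
    have : (0:ℝ) < n := by exact_mod_cast hn
    have := hφpos n
    exact mul_pos hK (by positivity)
  have hlim : Tendsto (fun n : ℕ ↦ Real.exp (-(((2 * r - 1) / p * (φ n / (n : ℝ) ^ (1 / β))) ^ (-β)
      / 20))) atTop (nhds 0) :=
    Real.tendsto_exp_neg_atTop_nhds_zero.comp
      (((tendsto_rpow_neg_nhdsGT_zero (by linarith)).comp hbase).atTop_div_const (by norm_num))
  refine tendsto_of_tendsto_of_tendsto_of_le_of_le' tendsto_const_nhds hlim ?_ ?_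
  · refine Eventually.of_forall fun n ↦ pow_nonneg (integral_nonneg fun x ↦ ?_) n
    have : 0 < μ * r := by positivity
    positivity
  · filter_upwards [eventually_gt_atTop 0, hφinf.eventually_ge_atTop 1] with n hn hφ1
    have hn0 : (0:ℝ) < n := by exact_mod_cast hn
    have hφ0 := hφpos n
    have hbound := integral_exp_neg_mul_sqrt_le (μ := μ) (r := r) (θ := p / φ n) hμ (by linarith)
      (by positivity) ((div_le_one hφ0).mpr (by linarith))
    have hnn : 0 ≤ ∫ x in Set.Ici (0:ℝ), μ * r * Real.exp (-(μ * r) * x) *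
        √(1 + p / φ n * (Real.exp ((r - 1) * μ * x) / (r - 1) - β)) :=
      integral_nonneg fun x ↦ by
        have : 0 < μ * r := by positivity
        positivity
    have hpow : ((2 * r - 1) / p * (φ n / (n : ℝ) ^ (1 / β))) ^ (-β)
        = n * ((2 * r - 1) / (p / φ n)) ^ (-β) := by
      have h1 : (2 * r - 1) / p * (φ n / (n : ℝ) ^ (1 / β))
          = (n : ℝ) ^ (-(1 / β)) * ((2 * r - 1) / (p / φ n)) := by
        rw [Real.rpow_neg hn0.le]
        field_simp
      rw [h1, Real.mul_rpow (by positivity) (div_pos (by linarith) (by positivity)).le,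
        ← Real.rpow_mul hn0.le]
      congr 1
      rw [show -(1 / β) * -β = 1 by field_simp, Real.rpow_one]
    refine (pow_le_pow_left₀ hnn (hbound.trans (Real.one_sub_le_exp_neg _)) n).trans_eq ?_
    rw [← Real.exp_nat_mul, hpow]
    congr 1
    ring
end

section
/- Fix μ > 0, λ > 0 and r > 2, set β = r/(r−1) ∈ (1,2), and let φ : ℕ → [1,∞) satisfy limsup_{n→∞} n^{1/β}/φ(n) < ∞. Then for every ε > 0 there exists δ₀ ∈ (0,1] such that for every δ ∈ (0,δ₀], liminf_{n→∞} (∫₀^∞ λ e^{−λv} (∫₀^∞ μr e^{−μrx} √(Ξ(δe^{−μv}/φ(n), x)) dx) dv)ⁿ ≥ 1 − ε. -/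
open MeasureTheory Real Set Filter

lemma one_add_half_sub_min_le_sqrt_one_add {u : ℝ} (hu : -1 ≤ u) :
    1 + u / 2 - min (u ^ 2) |u| / 2 ≤ √(1 + u) := by
  obtain ⟨s, hs, rfl⟩ : ∃ s : ℝ, 0 ≤ s ∧ u = s ^ 2 - 1 :=
    ⟨√(1 + u), sqrt_nonneg _, by rw [sq_sqrt (by linarith)]; ring⟩
  rw [show 1 + (s ^ 2 - 1) = s ^ 2 by ring, sqrt_sq hs]
  have h1 : (s - 1) ^ 2 ≤ (s ^ 2 - 1) ^ 2 := by
    have : (s ^ 2 - 1) ^ 2 - (s - 1) ^ 2 = (s - 1) ^ 2 * (s * (s + 2)) := by ring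
    have : 0 ≤ (s - 1) ^ 2 * (s * (s + 2)) := by positivity
    linarith
  have h2 : (s - 1) ^ 2 ≤ |s ^ 2 - 1| := by
    rcases le_total 1 s with h | h
    · exact le_trans (by nlinarith) (le_abs_self _)
    · exact le_trans (by nlinarith) (neg_le_abs _)
  have := le_min h1 h2
  nlinarith

/-- The exponentially weighted truncation whose translates dominate the second-order error. -/
noncomputable def truncWeight (μ r z : ℝ) : ℝ :=
  exp (-(μ * r) * z) * min (exp ((r - 1) * μ * z) ^ 2) (exp ((r - 1) * μ * z))

lemma truncWeight_nonneg (μ r z : ℝ) : 0 ≤ truncWeight μ r z := by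
  unfold truncWeight; positivity

lemma integrable_truncWeight {μ r : ℝ} (hμ : 0 < μ) (hr : 2 < r) :
    Integrable (truncWeight μ r) := by
  have hm : AEStronglyMeasurable (truncWeight μ r) volume := by
    apply Continuous.aestronglyMeasurable
    unfold truncWeight
    fun_prop
  rw [← integrableOn_univ, ← Iic_union_Ioi (a := (0 : ℝ))]
  refine IntegrableOn.union ?_ ?_
  · refine Integrable.mono' (integrableOn_exp_mul_Iic (a := (r - 2) * μ) (by nlinarith) 0)
      hm.restrict (ae_of_all _ fun z => ?_)
    rw [norm_of_nonneg (truncWeight_nonneg _ _ _)]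
    calc truncWeight μ r z ≤ exp (-(μ * r) * z) * exp ((r - 1) * μ * z) ^ 2 := by
          unfold truncWeight; gcongr; exact min_le_left _ _
      _ = exp ((r - 2) * μ * z) := by
          rw [← exp_nat_mul, ← exp_add]; congr 1; push_cast; ring
  · refine Integrable.mono' (integrableOn_exp_mul_Ioi (a := -μ) (by linarith) 0)
      hm.restrict (ae_of_all _ fun z => ?_)
    rw [norm_of_nonneg (truncWeight_nonneg _ _ _)]
    calc truncWeight μ r z ≤ exp (-(μ * r) * z) * exp ((r - 1) * μ * z) := by
          unfold truncWeight; gcongr; exact min_le_right _ _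
      _ = exp (-μ * z) := by
          rw [← exp_add]; congr 1; ring

lemma exp_mul_min_eq_truncWeight {μ r θ : ℝ} (hμ : 0 < μ) (hr : 2 < r) (hθ : 0 < θ) (x : ℝ) :
    exp (-(μ * r) * x) * min ((θ * exp ((r - 1) * μ * x)) ^ 2) (θ * exp ((r - 1) * μ * x)) =
      θ ^ (r / (r - 1)) * truncWeight μ r (x - -log θ / ((r - 1) * μ)) := by
  have hr1 : r - 1 ≠ 0 := by linarith
  have hμ' := hμ.ne'
  have h1 : exp ((r - 1) * μ * (x - -log θ / ((r - 1) * μ))) = θ * exp ((r - 1) * μ * x) := by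
    conv_rhs => rw [← exp_log hθ, ← exp_add]
    congr 1
    field_simp
    ring
  unfold truncWeight
  rw [h1, ← mul_assoc, rpow_def_of_pos hθ, ← exp_add]
  congr 2
  field_simp
  ring

lemma integrableOn_exp_neg_mul_Ici {a : ℝ} (ha : 0 < a) :
    IntegrableOn (fun x => exp (-a * x)) (Ici 0) := by
  rw [integrableOn_Ici_iff_integrableOn_Ioi]
  exact integrableOn_exp_mul_Ioi (by linarith) 0

lemma integral_exp_neg_mul_Ici {a : ℝ} (ha : 0 < a) :
    ∫ x in Ici (0 : ℝ), exp (-a * x) = 1 / a := by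
  rw [integral_Ici_eq_integral_Ioi, integral_exp_mul_Ioi (by linarith)]
  simp

/-- `E[1 + θ(e^{(r-1)μX}/(r-1) - β)/2] = 1` for `X` exponential of rate `μr`, together with the
integrability behind it. -/
lemma integral_linearized {μ r : ℝ} (hμ : 0 < μ) (hr : 2 < r) (θ : ℝ) :
    IntegrableOn (fun x => μ * r * exp (-(μ * r) * x) *
      (1 + θ * (exp ((r - 1) * μ * x) / (r - 1) - r / (r - 1)) / 2)) (Ici 0) ∧
    ∫ x in Ici (0 : ℝ), μ * r * exp (-(μ * r) * x) *
      (1 + θ * (exp ((r - 1) * μ * x) / (r - 1) - r / (r - 1)) / 2) = 1 := by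
  have hr1 : r - 1 ≠ 0 := by linarith
  have hr0 : r ≠ 0 := by linarith
  have hμ0 := hμ.ne'
  have hμr : 0 < μ * r := by nlinarith
  have heq : (fun x => μ * r * exp (-(μ * r) * x) *
      (1 + θ * (exp ((r - 1) * μ * x) / (r - 1) - r / (r - 1)) / 2)) =
      fun x => (μ * r * (1 - θ * (r / (r - 1)) / 2)) * exp (-(μ * r) * x) +
        (μ * r * θ / (r - 1) / 2) * exp (-μ * x) := by
    ext x
    rw [show -μ * x = -(μ * r) * x + (r - 1) * μ * x by ring, exp_add]
    field_simp
    ring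
  have i1 := (integrableOn_exp_neg_mul_Ici hμr).const_mul (μ * r * (1 - θ * (r / (r - 1)) / 2))
  have i2 := (integrableOn_exp_neg_mul_Ici hμ).const_mul (μ * r * θ / (r - 1) / 2)
  rw [heq]
  refine ⟨i1.add i2, ?_⟩
  rw [integral_add i1 i2, integral_const_mul, integral_const_mul, integral_exp_neg_mul_Ici hμr,
    integral_exp_neg_mul_Ici hμ]
  field_simp
  ring

lemma neg_one_le_mul_tilt {μ r θ x : ℝ} (hμ : 0 < μ) (hr : 2 < r) (hθ : 0 ≤ θ) (hθ1 : θ ≤ 1)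
    (hx : 0 ≤ x) : -1 ≤ θ * (exp ((r - 1) * μ * x) / (r - 1) - r / (r - 1)) := by
  have hr1 : 0 < r - 1 := by linarith
  have hy : 1 ≤ exp ((r - 1) * μ * x) := one_le_exp (by positivity)
  have : -1 ≤ exp ((r - 1) * μ * x) / (r - 1) - r / (r - 1) := by
    rw [← sub_div, le_div_iff₀ hr1]; linarith
  nlinarith

lemma abs_tilt_le {r y : ℝ} (hr : 2 < r) (hy : 1 ≤ y) : |y / (r - 1) - r / (r - 1)| ≤ 2 * y := by
  have hr1 : 0 < r - 1 := by linarith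
  rw [← sub_div, abs_div, abs_of_pos hr1, div_le_iff₀ hr1, abs_le]
  constructor <;> nlinarith

/-- `E[√Ξ(θ, X)]` for `X` exponential of rate `μr`. -/
noncomputable def sqrtAffinity (μ r θ : ℝ) : ℝ :=
  ∫ x in Ici (0 : ℝ), μ * r * exp (-(μ * r) * x) *
    √(1 + θ * (exp ((r - 1) * μ * x) / (r - 1) - r / (r - 1)))

lemma sqrtAffinity_nonneg {μ r : ℝ} (hμ : 0 < μ) (hr : 2 < r) (θ : ℝ) :
    0 ≤ sqrtAffinity μ r θ :=
  integral_nonneg fun x => by have : 0 < r := by linarith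
                              positivity

lemma integrableOn_sqrtAffinity {μ r θ : ℝ} (hμ : 0 < μ) (hr : 2 < r) (hθ : 0 ≤ θ)
    (hθ1 : θ ≤ 1) :
    IntegrableOn (fun x => μ * r * exp (-(μ * r) * x) *
      √(1 + θ * (exp ((r - 1) * μ * x) / (r - 1) - r / (r - 1)))) (Ici 0) := by
  have hr0 : 0 < r := by linarith
  refine Integrable.mono' (integral_linearized hμ hr θ).1
    (Continuous.aestronglyMeasurable (by fun_prop)) ?_
  filter_upwards [ae_restrict_mem measurableSet_Ici] with x hx
  rw [norm_of_nonneg (by positivity)]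
  gcongr
  exact Real.sqrt_one_add_le (neg_one_le_mul_tilt hμ hr hθ hθ1 hx)

lemma sqrtAffinity_le_one {μ r θ : ℝ} (hμ : 0 < μ) (hr : 2 < r) (hθ : 0 ≤ θ) (hθ1 : θ ≤ 1) :
    sqrtAffinity μ r θ ≤ 1 := by
  have hr0 : 0 < r := by linarith
  rw [← (integral_linearized hμ hr θ).2]
  refine setIntegral_mono_on (integrableOn_sqrtAffinity hμ hr hθ hθ1)
    (integral_linearized hμ hr θ).1 measurableSet_Ici fun x hx => ?_
  gcongr
  exact Real.sqrt_one_add_le (neg_one_le_mul_tilt hμ hr hθ hθ1 hx)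

lemma one_sub_mul_rpow_le_sqrtAffinity {μ r θ : ℝ} (hμ : 0 < μ) (hr : 2 < r) (hθ : 0 < θ)
    (hθ1 : θ ≤ 1) :
    1 - 2 * (μ * r) * (∫ z, truncWeight μ r z) * θ ^ (r / (r - 1)) ≤ sqrtAffinity μ r θ := by
  have hr0 : 0 < r := by linarith
  set T := -log θ / ((r - 1) * μ)
  have hW : Integrable fun x => 2 * (μ * r) * (θ ^ (r / (r - 1)) * truncWeight μ r (x - T)) :=
    (((integrable_truncWeight hμ hr).comp_sub_right T).const_mul _).const_mul _
  have hle : ∫ x in Ici (0 : ℝ), 2 * (μ * r) * (θ ^ (r / (r - 1)) * truncWeight μ r (x - T)) ≤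
      2 * (μ * r) * (∫ z, truncWeight μ r z) * θ ^ (r / (r - 1)) := by
    refine (setIntegral_le_integral hW (ae_of_all _ fun x => ?_)).trans_eq ?_
    · have := truncWeight_nonneg μ r (x - T)
      simp only [Pi.zero_apply]
      positivity
    · rw [integral_const_mul, integral_const_mul, integral_sub_right_eq_self (truncWeight μ r) T]
      ring
  obtain ⟨hL, hL1⟩ := integral_linearized hμ hr θ
  refine le_trans (sub_le_sub_left hle 1) ?_
  refine ((congrArg (· - _) hL1.symm).trans (integral_sub hL hW.integrableOn).symm).trans_le ?_
  refine setIntegral_mono_on (hL.sub hW.integrableOn) (integrableOn_sqrtAffinity hμ hr hθ.le hθ1)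
    measurableSet_Ici fun x hx => ?_
  rw [← exp_mul_min_eq_truncWeight hμ hr hθ]
  have hx : 0 ≤ x := hx
  have hy : 1 ≤ exp ((r - 1) * μ * x) :=
    one_le_exp (by have : 0 < r - 1 := by linarith
                   positivity)
  have hu := one_add_half_sub_min_le_sqrt_one_add (neg_one_le_mul_tilt hμ hr hθ.le hθ1 hx)
  have hh := abs_tilt_le hr hy
  set y := exp ((r - 1) * μ * x)
  set u := θ * (y / (r - 1) - r / (r - 1)) with hu_def
  have habs : |u| ≤ 2 * (θ * y) := by
    rw [hu_def, abs_mul, abs_of_pos hθ]; nlinarith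
  have hmin : min (u ^ 2) |u| ≤ 4 * min ((θ * y) ^ 2) (θ * y) := by
    have hty : 0 < θ * y := by positivity
    rw [mul_min_of_nonneg _ _ (by norm_num : (0 : ℝ) ≤ 4)]
    refine min_le_min ?_ (by linarith)
    rw [← sq_abs]
    nlinarith [abs_nonneg u]
  calc _ = μ * r * exp (-(μ * r) * x) * (1 + u / 2 - 4 * min ((θ * y) ^ 2) (θ * y) / 2) := by ring
    _ ≤ _ := by gcongr; linarith

lemma measurable_sqrtAffinity (μ r : ℝ) : Measurable (sqrtAffinity μ r) := by
  have : StronglyMeasurable (Function.uncurry fun θ x : ℝ => μ * r * exp (-(μ * r) * x) *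
      √(1 + θ * (exp ((r - 1) * μ * x) / (r - 1) - r / (r - 1)))) := by
    apply Continuous.stronglyMeasurable
    unfold Function.uncurry
    fun_prop
  exact (this.integral_prod_right (ν := volume.restrict (Ici 0))).measurable

/-- The averaged affinity lies between `1 - C q^β` and `1`. -/
lemma integral_sqrtAffinity_bounds {μ lam r q : ℝ} (hμ : 0 < μ) (hlam : 0 < lam) (hr : 2 < r)
    (hq : 0 < q) (hq1 : q ≤ 1) :
    1 - 2 * (μ * r) * (∫ z, truncWeight μ r z) * q ^ (r / (r - 1)) ≤
      ∫ v in Ici (0 : ℝ), lam * exp (-lam * v) * sqrtAffinity μ r (q * exp (-μ * v)) ∧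
    0 ≤ ∫ v in Ici (0 : ℝ), lam * exp (-lam * v) * sqrtAffinity μ r (q * exp (-μ * v)) ∧
    ∫ v in Ici (0 : ℝ), lam * exp (-lam * v) * sqrtAffinity μ r (q * exp (-μ * v)) ≤ 1 := by
  have hr0 : 0 < r := by linarith
  have hβ : 0 ≤ r / (r - 1) := div_nonneg hr0.le (by linarith)
  have hθ : ∀ v, 0 ≤ v → q * exp (-μ * v) ≤ q := fun v hv =>
    mul_le_of_le_one_right hq.le (exp_le_one_iff.2 (by nlinarith))
  have hθ0 : ∀ v, 0 < q * exp (-μ * v) := fun v => by positivity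
  have hd : IntegrableOn (fun v => lam * exp (-lam * v)) (Ici 0) :=
    (integrableOn_exp_neg_mul_Ici hlam).const_mul lam
  have hd1 : ∫ v in Ici (0 : ℝ), lam * exp (-lam * v) = 1 := by
    rw [integral_const_mul, integral_exp_neg_mul_Ici hlam, mul_one_div_cancel hlam.ne']
  have hupper : ∀ v ∈ Ici (0 : ℝ),
      lam * exp (-lam * v) * sqrtAffinity μ r (q * exp (-μ * v)) ≤ lam * exp (-lam * v) :=
    fun v hv => mul_le_of_le_one_right (by positivity)
      (sqrtAffinity_le_one hμ hr (hθ0 v).le ((hθ v hv).trans hq1))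
  have hnonneg : ∀ v, 0 ≤ lam * exp (-lam * v) * sqrtAffinity μ r (q * exp (-μ * v)) :=
    fun v => mul_nonneg (by positivity) (sqrtAffinity_nonneg hμ hr _)
  have hint : IntegrableOn
      (fun v => lam * exp (-lam * v) * sqrtAffinity μ r (q * exp (-μ * v))) (Ici 0) := by
    refine Integrable.mono' hd (Measurable.aestronglyMeasurable ?_) ?_
    · have := measurable_sqrtAffinity μ r
      fun_prop
    · filter_upwards [ae_restrict_mem measurableSet_Ici] with v hv
      rw [norm_of_nonneg (hnonneg v)]
      exact hupper v hv
  refine ⟨?_, integral_nonneg hnonneg, ?_⟩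
  · have hC : 0 ≤ 2 * (μ * r) * ∫ z, truncWeight μ r z :=
      mul_nonneg (by positivity) (integral_nonneg (truncWeight_nonneg μ r))
    set K := 1 - 2 * (μ * r) * (∫ z, truncWeight μ r z) * q ^ (r / (r - 1)) with hK
    have hKint : ∫ v in Ici (0 : ℝ), lam * exp (-lam * v) * K = K := by
      rw [integral_mul_const, hd1, one_mul]
    rw [← hKint]
    refine setIntegral_mono_on (hd.mul_const K) hint measurableSet_Ici fun v hv => ?_
    gcongr
    refine le_trans ?_ (one_sub_mul_rpow_le_sqrtAffinity hμ hr (hθ0 v) ((hθ v hv).trans hq1))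
    rw [hK]
    have := rpow_le_rpow (hθ0 v).le (hθ v hv) hβ
    gcongr
  · rw [← hd1]
    exact setIntegral_mono_on hint hd measurableSet_Ici hupper


/-- For `μ, λ > 0`, `r > 2` with `β = r/(r−1) ∈ (1,2)`, and
`φ : ℕ → [1,∞)` with `limsup n^{1/β}/φ(n) < ∞` (i.e. the sequence
`n^{1/β}/φ(n)` is eventually bounded above), for every `ε > 0` there is
`δ₀ ∈ (0,1]` such that for every `δ ∈ (0,δ₀]`,
`liminf_n (∫₀^∞ λe^{−λv} ∫₀^∞ μre^{−μrx} √Ξ(δe^{−μv}/φ(n),x) dx dv)ⁿ ≥ 1 − ε`. -/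
theorem affinity_power_liminf_ge_r_gt_two
    (μ lam r : ℝ) (hμ : 0 < μ) (hlam : 0 < lam) (hr : 2 < r)
    (φ : ℕ → ℝ) (hφ : ∀ n, 1 ≤ φ n)
    (hbdd : Filter.IsBoundedUnder (· ≤ ·) Filter.atTop
      (fun n : ℕ => (n : ℝ) ^ (1 / (r / (r - 1))) / φ n)) :
    ∀ ε : ℝ, 0 < ε →
      ∃ δ₀ : ℝ, 0 < δ₀ ∧ δ₀ ≤ 1 ∧
        ∀ δ : ℝ, 0 < δ → δ ≤ δ₀ →
          1 - ε ≤ Filter.liminf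
            (fun n : ℕ =>
              (∫ v in Set.Ici (0:ℝ),
                  lam * Real.exp (-lam * v) *
                    ∫ x in Set.Ici (0:ℝ),
                      μ * r * Real.exp (-(μ * r) * x) *
                        Real.sqrt (1 + (δ * Real.exp (-μ * v) / φ n) *
                          (Real.exp ((r - 1) * μ * x) / (r - 1) - r / (r - 1)))) ^ n)
            Filter.atTop := by
  intro ε hε
  set β := r / (r - 1) with hβ_def
  have hr1 : 0 < r - 1 := by linarith
  have hr0 : 0 < r := by linarith
  have hβ1 : 1 ≤ β := by rw [hβ_def, le_div_iff₀ hr1]; linarith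
  have hβ0 : 0 < β := by linarith
  set C := 2 * (μ * r) * ∫ z, truncWeight μ r z with hC_def
  have hC : 0 ≤ C := mul_nonneg (by positivity) (integral_nonneg (truncWeight_nonneg μ r))
  obtain ⟨M₀, hM₀⟩ := hbdd
  rw [eventually_map] at hM₀
  set M := max M₀ 1
  have hM1 : 1 ≤ M := le_max_right _ _
  have hD : 0 < C * M ^ β + 1 := by positivity
  refine ⟨min 1 (min ε 1 / (C * M ^ β + 1)), by positivity, min_le_left _ _, fun δ hδ hδ₀ => ?_⟩
  have hδ1 : δ ≤ 1 := hδ₀.trans (min_le_left _ _)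
  have hδD : δ * (C * M ^ β + 1) ≤ min ε 1 := (le_div_iff₀ hD).1 (hδ₀.trans (min_le_right _ _))
  have hδβ : δ ^ β ≤ δ := by
    simpa using rpow_le_rpow_of_exponent_ge hδ hδ1 hβ1
  have hq : ∀ n, 0 < δ / φ n := fun n => div_pos hδ (by linarith [hφ n])
  have hqδ : ∀ n, δ / φ n ≤ δ := fun n => div_le_self hδ.le (hφ n)
  have hrw : ∀ n v, sqrtAffinity μ r (δ / φ n * exp (-μ * v)) =
      ∫ x in Ici (0 : ℝ), μ * r * exp (-(μ * r) * x) *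
        √(1 + (δ * exp (-μ * v) / φ n) * (exp ((r - 1) * μ * x) / (r - 1) - β)) := by
    intro n v
    rw [sqrtAffinity, div_mul_eq_mul_div]
  have hbounds := fun n =>
    integral_sqrtAffinity_bounds hμ hlam hr (hq n) ((hqδ n).trans hδ1)
  simp only [hrw] at hbounds
  refine le_liminf_of_le ?_ ?_
  · exact IsBoundedUnder.isCoboundedUnder_ge
      ⟨1, eventually_map.2 (Eventually.of_forall fun n =>
        pow_le_one₀ (hbounds n).2.1 (hbounds n).2.2)⟩
  filter_upwards [hM₀] with n hn
  obtain ⟨hlow, hJ0, -⟩ := hbounds n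
  have hφ0 : 0 < φ n := by linarith [hφ n]
  have hMβ : 1 ≤ M ^ β := one_le_rpow hM1 hβ0.le
  have hsmall : C * (δ / φ n) ^ β ≤ 1 := by
    have h1 : (δ / φ n) ^ β ≤ δ := (rpow_le_rpow (hq n).le (hqδ n) hβ0.le).trans hδβ
    have h2 : δ * (C * M ^ β + 1) ≤ 1 := hδD.trans (min_le_right _ _)
    have h3 : C * (δ / φ n) ^ β ≤ C * δ := by gcongr
    have h4 : C * δ ≤ δ * (C * M ^ β) := by
      have : C * δ * 1 ≤ C * δ * M ^ β := by gcongr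
      linarith
    nlinarith
  have hscale : n * (C * (δ / φ n) ^ β) ≤ ε := by
    have h1 : ((n : ℝ) ^ (1 / β) / φ n) ^ β ≤ M ^ β :=
      rpow_le_rpow (by positivity) (hn.trans (le_max_left _ _)) hβ0.le
    rw [div_rpow (by positivity) hφ0.le, ← rpow_mul (by positivity), one_div_mul_cancel hβ0.ne',
      rpow_one] at h1
    have h2 : n * (C * (δ / φ n) ^ β) = C * δ ^ β * (n / φ n ^ β) := by
      rw [div_rpow hδ.le hφ0.le]; ring
    have h3 : C * δ ^ β * (n / φ n ^ β) ≤ C * δ * M ^ β := by gcongr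
    have h4 : δ * (C * M ^ β + 1) ≤ ε := hδD.trans (min_le_left _ _)
    rw [h2]
    nlinarith
  calc 1 - ε ≤ 1 + n * (-(C * (δ / φ n) ^ β)) := by linarith
    _ ≤ (1 + -(C * (δ / φ n) ^ β)) ^ n := one_add_mul_le_pow (by linarith) n
    _ ≤ _ := pow_le_pow_left₀ (by linarith) (by linarith) n
end
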